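/- arXiv:2603.05736 — 2 statements merged into one kernel-verified Lean document; each statement's English description precedes it below -/
import Mathlib

section
/- Let s, m_1, m_2 be integers with s ≥ 0 and 2 ≤ m_1 ≤ m_2, set m = m_1 + m_2 and n = s + m. If n ≡ 1 (mod 2m), then HOP(2^⟨s⟩, 2m_1, 2m_2) has a solution. -/
/-- The vertex set of the complete graph `K_{2n}`: the `n` couples are indexed by `Fin n`,
and the two members of a couple by `Fin 2`. -/
abbrev HOPVertex (n : ℕ) : Type := Fin n × Fin 2

/-- The spouse of a participant: the other member of the same couple. -/
def HOPspouse {n : ℕ} (v : HOPVertex n) : HOPVertex n := (v.1, v.2 + 1)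

/-- An edge of `K_{2n}` is an `I`-edge (an edge of the distinguished perfect matching `I`)
if it joins a participant to their spouse. -/
def IsIEdge {n : ℕ} (e : Sym2 (HOPVertex n)) : Prop :=
  ∃ v, e = s(v, HOPspouse v)

/-- An `I`-alternating `(K_2^⟨s⟩, C_{2m_1}, …, C_{2m_t})`-factor of `K_{2n}`:
a spanning subgraph of `K_{2n}` which is a vertex-disjoint union of `s` edges of `I`
(one for each `a : Fin s`, namely the edge joining `pair a` to its spouse) together with
`t` cycles, the `i`-th of which has length `2 * m i` (given by the cyclic vertex sequence
`cyc i : ZMod (2 * m i) → HOPVertex n`), such that along each cycle the edges alternate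
between `I`-edges (at even positions) and non-`I`-edges (at odd positions).
The field `spanning` says that the listed vertices are pairwise distinct and exhaust the
whole vertex set; in particular each `cyc i` is injective, so it really traces a cycle. -/
structure HOPFactor (n s t : ℕ) (m : Fin t → ℕ) : Type where
  pair : Fin s → HOPVertex n
  cyc : (i : Fin t) → ZMod (2 * m i) → HOPVertex n
  alt_even : ∀ (i : Fin t) (j : ZMod (2 * m i)),
      j.val % 2 = 0 → cyc i (j + 1) = HOPspouse (cyc i j)
  alt_odd : ∀ (i : Fin t) (j : ZMod (2 * m i)),
      j.val % 2 = 1 → ¬ IsIEdge s(cyc i j, cyc i (j + 1))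
  spanning : Function.Bijective
      (Sum.elim
        (fun a : Fin s × Fin 2 => if a.2 = 0 then pair a.1 else HOPspouse (pair a.1))
        (fun x : (i : Fin t) × ZMod (2 * m i) => cyc x.1 x.2))

/-- The edge set of an `I`-alternating `(K_2^⟨s⟩, C_{2m_1}, …, C_{2m_t})`-factor. -/
def HOPFactor.edges {n s t : ℕ} {m : Fin t → ℕ} (F : HOPFactor n s t m) :
    Set (Sym2 (HOPVertex n)) :=
  {e | (∃ a : Fin s, e = s(F.pair a, HOPspouse (F.pair a))) ∨
    ∃ (i : Fin t) (j : ZMod (2 * m i)), e = s(F.cyc i j, F.cyc i (j + 1))}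

/-- A solution to the generalized Honeymoon Oberwolfach Problem
`HOP(2^⟨s⟩, 2 m_1, …, 2 m_t)`: a family of `γ` `I`-alternating
`(K_2^⟨s⟩, C_{2m_1}, …, C_{2m_t})`-factors of `K_{2n}`, where `γ` is the natural number
with `γ * (m_1 + ⋯ + m_t) = 2n(n-1)`, such that every edge of `K_{2n}` that is not an
`I`-edge lies in exactly one factor of the family. -/
def HOPSolution (n s t : ℕ) (m : Fin t → ℕ) : Prop :=
  ∃ γ : ℕ, γ * (∑ i, m i) = 2 * n * (n - 1) ∧
    ∃ F : Fin γ → HOPFactor n s t m,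
      ∀ e : Sym2 (HOPVertex n), ¬ e.IsDiag → ¬ IsIEdge e →
        ∃! k : Fin γ, e ∈ (F k).edges

set_option linter.unusedVariables false
set_option linter.unusedSimpArgs false


/-! ### Integer quads -/

/-- Four labelled `l`-cycles in `[0,W)` covering all four types of each difference in `S`. -/
def HasQuad (l : ℕ) (S : ℕ → Prop) (W : ℕ) : Prop :=
  ∃ (f : Fin 4 → ℕ → ℤ) (x : Fin 4 → ℕ → Fin 2),
    (∀ p i, i < l → 0 ≤ f p i ∧ f p i < W) ∧
    (∀ p i j, i < l → j < l → f p i = f p j → i = j) ∧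
    ∀ d, S d → ∀ a b : Fin 2, ∃ p, ∃ i, i < l ∧
      ((f p ((i + 1) % l) - f p i = d ∧ x p i = a ∧ x p ((i + 1) % l) + 1 = b) ∨
       (f p i - f p ((i + 1) % l) = d ∧ x p i = b ∧ x p ((i + 1) % l) + 1 = a))

/-- One `l`-cycle in `[0,W)` whose differences cover `S`. -/
def HasCycle (l : ℕ) (S : ℕ → Prop) (W : ℕ) : Prop :=
  ∃ f : ℕ → ℤ, (∀ i, i < l → 0 ≤ f i ∧ f i < W) ∧
    (∀ i j, i < l → j < l → f i = f j → i = j) ∧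
    ∀ d, S d → ∃ i, i < l ∧
      (f ((i + 1) % l) - f i = d ∨ f i - f ((i + 1) % l) = d)

lemma HasQuad.mono {l S W W'} (h : HasQuad l S W) (hW : W ≤ W') : HasQuad l S W' := by
  obtain ⟨f, x, h1, h2, h3⟩ := h
  refine ⟨f, x, fun p i hi => ?_, h2, h3⟩
  have := h1 p i hi
  omega

/-- the three balanced vectors -/
def balVec : Fin 3 → Fin 4 → Fin 2
  | 0 => ![0, 0, 1, 1]
  | 1 => ![0, 1, 0, 1]
  | 2 => ![0, 1, 1, 0]

lemma balVec_orth : ∀ c c' : Fin 3, c ≠ c' → ∀ a b : Fin 2,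
    ∃ p, balVec c p = a ∧ balVec c' p + 1 = b := by decide

def cycCol (l i : ℕ) : Fin 3 :=
  if l % 2 = 1 ∧ i + 1 = l then 2 else if i % 2 = 0 then 0 else 1

lemma nxt_eq {l i : ℕ} (hi : i < l) : (i + 1) % l = if i + 1 = l then 0 else i + 1 := by
  split_ifs with h
  · rw [h, Nat.mod_self]
  · exact Nat.mod_eq_of_lt (by omega)

lemma cycCol_ne {l i : ℕ} (hl : 2 ≤ l) (hi : i < l) : cycCol l i ≠ cycCol l ((i + 1) % l) := by
  rw [nxt_eq hi]
  unfold cycCol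
  split_ifs <;> first | decide | (exfalso; omega)

lemma HasCycle.quad {l S W} (hl : 2 ≤ l) (h : HasCycle l S W) : HasQuad l S W := by
  obtain ⟨f, h1, h2, h3⟩ := h
  refine ⟨fun _ => f, fun p i => balVec (cycCol l i) p, fun _ => h1, fun _ => h2, ?_⟩
  intro d hd a b
  obtain ⟨i, hi, h | h⟩ := h3 d hd
  · obtain ⟨p, hp⟩ := balVec_orth _ _ (cycCol_ne hl hi) a b
    exact ⟨p, i, hi, Or.inl ⟨h, hp⟩⟩
  · obtain ⟨p, hp⟩ := balVec_orth _ _ (cycCol_ne hl hi) b a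
    exact ⟨p, i, hi, Or.inr ⟨h, hp⟩⟩

/-! ### Small quads -/

/-- Two-cycles: any two differences. -/
lemma quad_two (D D' : ℕ) (hD : 0 < D) (hDD : D ≤ D') :
    HasQuad 2 (fun d => d = D ∨ d = D') (D' + 1) := by
  refine ⟨fun p i => if i = 0 then 0 else if p.val < 2 then D else D',
    fun p i => if i = 0 then 0 else ![0, 1, 0, 1] p, ?_, ?_, ?_⟩
  · intro p i hi
    dsimp only
    split_ifs <;> omega
  · intro p i j hi hj
    dsimp only
    split_ifs <;> omega
  · rintro d (rfl | rfl) a b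
    · have : ∃ p : Fin 4, p.val < 2 ∧ ∃ i, i < 2 ∧
        ((i = 0 ∧ (0 : Fin 2) = a ∧ (![0, 1, 0, 1] p : Fin 2) + 1 = b) ∨
          (i = 1 ∧ (![0, 1, 0, 1] p : Fin 2) = b ∧ (0 : Fin 2) + 1 = a)) := by
        revert a b; decide
      obtain ⟨p, hp, i, hi, ⟨rfl, h⟩ | ⟨rfl, h⟩⟩ := this
      · exact ⟨p, 0, hi, Or.inl (by simpa [hp] using h)⟩
      · refine ⟨p, 1, hi, Or.inr ?_⟩
        simpa [hp] using h
    · have : ∃ p : Fin 4, ¬ p.val < 2 ∧ ∃ i, i < 2 ∧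
        ((i = 0 ∧ (0 : Fin 2) = a ∧ (![0, 1, 0, 1] p : Fin 2) + 1 = b) ∨
          (i = 1 ∧ (![0, 1, 0, 1] p : Fin 2) = b ∧ (0 : Fin 2) + 1 = a)) := by
        revert a b; decide
      obtain ⟨p, hp, i, hi, ⟨rfl, h⟩ | ⟨rfl, h⟩⟩ := this
      · exact ⟨p, 0, hi, Or.inl (by simpa [hp] using h)⟩
      · refine ⟨p, 1, hi, Or.inr ?_⟩
        simpa [hp] using h

/-- vertices of the five-cycle -/
def fiveV (t e D : ℤ) : ℕ → ℤ
  | 0 => t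
  | 1 => t + e
  | 2 => 0
  | 3 => D
  | _ => D + t

def fiveX : ℕ → Fin 4 → Fin 2
  | 0 => ![0, 1, 1, 0]
  | 1 => ![0, 0, 1, 1]
  | 2 => ![0, 1, 0, 1]
  | 3 => ![0, 1, 0, 1]
  | _ => ![1, 0, 0, 1]

lemma quad_five (t e D D' : ℕ) (ht : 0 < t) (hte : t < e) (hD : e < D) (hDD : D ≤ D')
    (h1 : D ≠ e + t) (h2 : D' ≠ e + t) :
    HasQuad 5 (fun d => d = t ∨ d = e ∨ d = e + t ∨ d = D ∨ d = D') (D' + t + 1) := by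
  refine ⟨fun p => fiveV t e (if p.val < 2 then D else D'), fun p i => fiveX i p, ?_, ?_, ?_⟩
  · intro p i hi
    dsimp only
    interval_cases i <;> simp only [fiveV] <;> (try split_ifs) <;> omega
  · intro p i j hi hj
    dsimp only
    interval_cases i <;> interval_cases j <;> simp only [fiveV] <;> (try split_ifs) <;>
      first | (intros; trivial) | omega
  · intro d hd a b
    rcases hd with h | h | h | h | h
    · have : ∃ p : Fin 4, fiveX 3 p = a ∧ fiveX 4 p + 1 = b := by revert a b; decide
      obtain ⟨p, hp⟩ := this
      exact ⟨p, 3, by norm_num, Or.inl ⟨by simp [fiveV, h], hp⟩⟩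
    · have : ∃ p : Fin 4, fiveX 0 p = a ∧ fiveX 1 p + 1 = b := by revert a b; decide
      obtain ⟨p, hp⟩ := this
      exact ⟨p, 0, by norm_num, Or.inl ⟨by simp [fiveV, h], hp⟩⟩
    · have : ∃ p : Fin 4, fiveX 1 p = b ∧ fiveX 2 p + 1 = a := by revert a b; decide
      obtain ⟨p, hp⟩ := this
      exact ⟨p, 1, by norm_num, Or.inr ⟨by simp [fiveV, h]; ring, hp⟩⟩
    · have : ∃ p : Fin 4, p.val < 2 ∧ ((fiveX 2 p = a ∧ fiveX 3 p + 1 = b) ∨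
          (fiveX 4 p = b ∧ fiveX 0 p + 1 = a)) := by revert a b; decide
      obtain ⟨p, hp, hq | hq⟩ := this
      · exact ⟨p, 2, by norm_num, Or.inl ⟨by simp [fiveV, h, hp], hq⟩⟩
      · exact ⟨p, 4, by norm_num, Or.inr ⟨by simp [fiveV, h, hp], hq⟩⟩
    · have : ∃ p : Fin 4, ¬ p.val < 2 ∧ ((fiveX 2 p = a ∧ fiveX 3 p + 1 = b) ∨
          (fiveX 4 p = b ∧ fiveX 0 p + 1 = a)) := by revert a b; decide
      obtain ⟨p, hp, hq | hq⟩ := this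
      · exact ⟨p, 2, by norm_num, Or.inl ⟨by simp only [fiveV, h, hp, if_false]; simp [fiveV], hq⟩⟩
      · exact ⟨p, 4, by norm_num, Or.inr ⟨by simp only [fiveV, h, hp, if_false]; simp [fiveV], hq⟩⟩

lemma quad_three (t e : ℕ) (ht : 0 < t) (hte : t < e) :
    HasQuad 3 (fun d => d = t ∨ d = e ∨ d = e + t) (e + t + 1) := by
  apply HasCycle.quad (by norm_num)
  refine ⟨fun i => if i = 0 then 0 else if i = 1 then t else e + t, ?_, ?_, ?_⟩
  · intro i hi
    dsimp only
    split_ifs <;> omega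
  · intro i j hi hj
    dsimp only
    split_ifs <;> omega
  · rintro d (h | h | h)
    · exact ⟨0, by norm_num, Or.inl (by simp [h])⟩
    · exact ⟨1, by norm_num, Or.inl (by simp [h])⟩
    · exact ⟨2, by norm_num, Or.inr (by simp [h])⟩

/-! ### The zigzag even cycles -/

/-- zigzag vertices: `D` least difference, `g` bottom gap, `h` top gap. -/
def zig (q D g h : ℕ) (i : ℕ) : ℤ :=
  if i % 2 = 0 then
    (if i = 0 then 0
     else if i / 2 ≤ q - 1 - (q + h - g) / 2 then (i / 2 : ℕ) + h else (i / 2 : ℕ) + h + 1)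
  else if i + 1 = 2 * q then D + q + h
  else D + 2 * q - 1 + g + h - (i / 2 : ℕ)

/-- differences of the zigzag -/
def zigS (q D g h : ℕ) (d : ℕ) : Prop :=
  d = D ∨ (D + g < d ∧ d + 1 < D + g + 2 * q) ∨ d + 1 = D + 2 * q + g + h

lemma zig_bound {q D g h i : ℕ} (hq : 2 ≤ q) (hD : 0 < D) (hg : g ≤ 1) (hh : h ≤ 1)
    (hp : (q + g + h) % 2 = 0) (hi : i < 2 * q) :
    0 ≤ zig q D g h i ∧ zig q D g h i < D + 2 * q + g + h := by
  unfold zig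
  split_ifs <;> omega

lemma zig_even {q D g h i : ℕ} (hq : 2 ≤ q) (hD : 0 < D) (hg : g ≤ 1) (hh : h ≤ 1)
    (hp : (q + g + h) % 2 = 0) (hi : i < 2 * q) (h2 : i % 2 = 0) :
    zig q D g h i ≤ q + h := by
  unfold zig
  split_ifs <;> omega

lemma zig_odd {q D g h i : ℕ} (hq : 2 ≤ q) (hD : 0 < D) (hg : g ≤ 1) (hh : h ≤ 1)
    (hp : (q + g + h) % 2 = 0) (hi : i < 2 * q) (h2 : i % 2 = 1) :
    (D + q + h : ℤ) ≤ zig q D g h i := by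
  unfold zig
  split_ifs <;> omega

lemma zig_inj {q D g h i j : ℕ} (hq : 2 ≤ q) (hD : 0 < D) (hg : g ≤ 1) (hh : h ≤ 1)
    (hp : (q + g + h) % 2 = 0) (hi : i < 2 * q) (hj : j < 2 * q)
    (he : zig q D g h i = zig q D g h j) : i = j := by
  rcases Nat.mod_two_eq_zero_or_one i with h1 | h1 <;>
    rcases Nat.mod_two_eq_zero_or_one j with h2 | h2
  · unfold zig at he
    simp only [h1, h2, if_true] at he
    split_ifs at he <;> omega
  · have := zig_even hq hD hg hh hp hi h1
    have := zig_odd hq hD hg hh hp hj h2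
    omega
  · have := zig_even hq hD hg hh hp hj h2
    have := zig_odd hq hD hg hh hp hi h1
    omega
  · unfold zig at he
    simp only [h1, h2, one_ne_zero, if_false] at he
    split_ifs at he <;> omega

lemma zig_cover {q D g h d : ℕ} (hq : 2 ≤ q) (hD : 0 < D) (hg : g ≤ 1) (hh : h ≤ 1)
    (hp : (q + g + h) % 2 = 0) (hd : zigS q D g h d) :
    d = D + q + h ∨ ∃ i, i + 1 < 2 * q ∧
      (zig q D g h (i + 1) - zig q D g h i = d ∨ zig q D g h i - zig q D g h (i + 1) = d) := by
  by_cases hc : d = D + q + h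
  · exact Or.inl hc
  right
  rcases hd with hd | hd | hd
  · refine ⟨2 * q - 2, by omega, Or.inl ?_⟩
    unfold zig
    rw [if_neg (by omega), if_pos (by omega), if_pos (by omega), if_neg (by omega),
      if_neg (by omega)]
    omega
  · by_cases hlt : D + q + h < d
    · obtain ⟨v, hv⟩ : ∃ v, v + d + 1 = D + g + 2 * q := ⟨D + g + 2 * q - 1 - d, by omega⟩
      refine ⟨v, by omega, ?_⟩
      unfold zig
      rcases Nat.mod_two_eq_zero_or_one v with h1 | h1
      · left
        rw [if_neg (by omega), if_neg (by omega), if_pos (by omega), if_neg (by omega),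
          if_pos (by omega)]
        omega
      · right
        rw [if_neg (by omega), if_neg (by omega), if_pos (by omega), if_neg (by omega),
          if_pos (by omega)]
        omega
    · obtain ⟨v, hv⟩ : ∃ v, v + d + 2 = D + g + 2 * q := ⟨D + g + 2 * q - 2 - d, by omega⟩
      refine ⟨v, by omega, ?_⟩
      unfold zig
      rcases Nat.mod_two_eq_zero_or_one v with h1 | h1
      · left
        rw [if_neg (by omega), if_neg (by omega), if_pos (by omega), if_neg (by omega),
          if_neg (by omega)]
        omega
      · right
        rw [if_neg (by omega), if_neg (by omega), if_pos (by omega), if_neg (by omega),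
          if_neg (by omega)]
        omega
  · refine ⟨0, by omega, Or.inl ?_⟩
    unfold zig
    rw [if_neg (by omega), if_neg (by omega), if_pos (by omega), if_pos (by omega)]
    omega

lemma quad_even {q D g h : ℕ} (hq : 2 ≤ q) (hD : 0 < D) (hg : g ≤ 1) (hh : h ≤ 1)
    (hp : (q + g + h) % 2 = 0) :
    HasQuad (2 * q) (zigS q D g h) (D + 2 * q + g + h) := by
  apply HasCycle.quad (by omega)
  refine ⟨zig q D g h, ?_, ?_, ?_⟩
  · intro i hi
    have := zig_bound hq hD hg hh hp hi
    push_cast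
    exact this
  · intro i j hi hj
    exact zig_inj hq hD hg hh hp hi hj
  · intro d hd
    rcases zig_cover hq hD hg hh hp hd with hc | ⟨i, hi, hc⟩
    · refine ⟨2 * q - 1, by omega, Or.inr ?_⟩
      rw [nxt_eq (by omega), if_pos (by omega)]
      unfold zig
      rw [if_neg (by omega), if_pos (by omega), if_pos (by omega), if_pos (by omega)]
      omega
    · refine ⟨i, by omega, ?_⟩
      rw [nxt_eq (by omega), if_neg (by omega)]
      exact hc

/-- zigzag merged with a triangle. -/
lemma quad_merge {q D g h t e : ℕ} (hq : 2 ≤ q) (hg : g ≤ 1) (hh : h ≤ 1)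
    (hp : (q + g + h) % 2 = 0) (ht : 0 < t) (he : 0 < e) (hD : e + t < D) :
    HasQuad (2 * q + 3) (fun d => (d = t ∨ d = e ∨ d = e + t) ∨ zigS q D g h d)
      (D + 2 * q + g + h + t) := by
  have hD0 : 0 < D := by omega
  apply HasCycle.quad (by omega)
  let f : ℕ → ℤ := fun i => if i < 2 * q then zig q D g h i + t
    else if i = 2 * q then D + q + h - e else if i = 2 * q + 1 then D + q + h else 0
  have f0 : ∀ i, i < 2 * q → f i = zig q D g h i + t := fun i hi => by simp only [f]; rw [if_pos hi]
  have f1 : f (2 * q) = D + q + h - e := by simp [f]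
  have f2 : f (2 * q + 1) = D + q + h := by simp [f]
  have f3 : f (2 * q + 2) = 0 := by simp [f]
  have hz : zig q D g h (2 * q - 1) = D + q + h := by
    unfold zig
    rw [if_neg (by omega), if_pos (by omega)]
  have hz0 : zig q D g h 0 = 0 := by simp [zig]
  have key : ∀ i, i < 2 * q → (zig q D g h i ≤ q + h ∨ (D + q + h : ℤ) ≤ zig q D g h i) := by
    intro i hi
    rcases Nat.mod_two_eq_zero_or_one i with h1 | h1
    · exact Or.inl (zig_even hq hD0 hg hh hp hi h1)
    · exact Or.inr (zig_odd hq hD0 hg hh hp hi h1)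
  have hcase : ∀ i, i < 2 * q + 3 → i < 2 * q ∨ i = 2 * q ∨ i = 2 * q + 1 ∨ i = 2 * q + 2 := by
    intro i hi; omega
  refine ⟨f, ?_, ?_, ?_⟩
  · intro i hi
    rcases hcase i hi with h1 | h1 | h1 | h1
    · have := zig_bound hq hD0 hg hh hp h1
      rw [f0 i h1]
      push_cast
      omega
    · rw [h1, f1]; push_cast; omega
    · rw [h1, f2]; push_cast; omega
    · rw [h1, f3]; exact ⟨le_refl _, by omega⟩
  · intro i j hi hj hf
    rcases hcase i hi with h1 | h1 | h1 | h1 <;> rcases hcase j hj with h2 | h2 | h2 | h2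
    · rw [f0 i h1, f0 j h2] at hf
      exact zig_inj hq hD0 hg hh hp h1 h2 (by omega)
    all_goals first
      | omega
      | (exfalso
         first
          | (have hb := zig_bound hq hD0 hg hh hp h1
             have hk := key i h1
             rw [f0 i h1, h2] at hf
             simp only [f1, f2, f3] at hf
             omega)
          | (have hb := zig_bound hq hD0 hg hh hp h2
             have hk := key j h2
             rw [f0 j h2, h1] at hf
             simp only [f1, f2, f3] at hf
             omega)
          | (rw [h1, h2] at hf
             simp only [f1, f2, f3] at hf
             omega))
  · intro d hd
    rcases hd with (hd | hd | hd) | hd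
    · refine ⟨2 * q + 2, by omega, Or.inl ?_⟩
      rw [nxt_eq (by omega), if_pos (by omega), f3, f0 0 (by omega), hz0]
      omega
    · refine ⟨2 * q, by omega, Or.inl ?_⟩
      rw [nxt_eq (by omega), if_neg (by omega), f1, f2]
      omega
    · refine ⟨2 * q - 1, by omega, Or.inr ?_⟩
      rw [nxt_eq (by omega), if_neg (by omega), f0 _ (by omega), hz,
        show 2 * q - 1 + 1 = 2 * q by omega, f1]
      omega
    · rcases zig_cover hq hD0 hg hh hp hd with hc | ⟨i, hi, hc⟩
      · refine ⟨2 * q + 1, by omega, Or.inr ?_⟩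
        rw [nxt_eq (by omega), if_neg (by omega), f2, f3]
        omega
      · refine ⟨i, by omega, ?_⟩
        rw [nxt_eq (by omega), if_neg (by omega), f0 i (by omega), f0 (i + 1) (by omega)]
        omega

/-! ### Chains -/

def Cov (M h d : ℕ) : Prop := 1 ≤ d ∧ d ≤ M + h ∧ (h = 0 ∨ d ≠ M)

lemma HasQuad.sub {l S S' W} (h : HasQuad l S W) (hS : ∀ d, S' d → S d) : HasQuad l S' W := by
  obtain ⟨f, x, h1, h2, h3⟩ := h
  exact ⟨f, x, h1, h2, fun d hd => h3 d (hS d hd)⟩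

/-- the set of differences added in one step -/
def stepS (q M h h' d : ℕ) : Prop :=
  if q = 1 then d = M + 1 - h ∨ d = M + 2 else zigS q (M + 1 - h) h h' d

/-- the next gap -/
def stepH (q h : ℕ) : ℕ := if q = 1 then 0 else (q + h) % 2

lemma stepH_le (q h : ℕ) : stepH q h ≤ 1 := by
  unfold stepH; split_ifs <;> omega

lemma step_cover {q M h d : ℕ} (hq : 1 ≤ q) (hh : h ≤ 1) (hM : 1 ≤ M ∨ h = 0)
    (hd : Cov (M + 2 * q) (stepH q h) d) : Cov M h d ∨ stepS q M h (stepH q h) d := by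
  unfold Cov stepS stepH zigS at *
  by_cases h1 : q = 1
  · simp only [h1, if_true] at *
    omega
  · simp only [h1, if_false] at *
    omega

lemma step_even {q M h : ℕ} (hq : 1 ≤ q) (hh : h ≤ 1) (hM : 1 ≤ M ∨ h = 0) :
    HasQuad (2 * q) (stepS q M h (stepH q h)) (M + 2 * q + stepH q h + 1) := by
  by_cases h1 : q = 1
  · subst h1
    refine ((quad_two (M + 1 - h) (M + 2) (by omega) (by omega)).sub ?_).mono (by omega)
    intro d hd
    simpa [stepS] using hd
  · have h2 := stepH_le q h
    have h3 : (q + h + stepH q h) % 2 = 0 := by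
      unfold stepH; rw [if_neg h1]; omega
    refine ((quad_even (q := q) (D := M + 1 - h) (g := h) (h := stepH q h) (by omega) (by omega)
      hh h2 h3).sub ?_).mono (by omega)
    intro d hd
    simpa [stepS, h1] using hd

lemma step_odd {q M h t e : ℕ} (hq : 1 ≤ q) (hh : h ≤ 1) (hM : 1 ≤ M ∨ h = 0)
    (ht : 0 < t) (hte : t < e)
    (hc : e + t < M + 1 - h ∨ (q = 1 ∧ e < M + 1 - h ∧ e + t ≠ M + 1 - h ∧ e + t ≠ M + 2)) :
    HasQuad (2 * q + 3) (fun d => (d = t ∨ d = e ∨ d = e + t) ∨ stepS q M h (stepH q h) d)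
      (M + 2 * q + stepH q h + 1 + t) := by
  by_cases h1 : q = 1
  · subst h1
    refine ((quad_five t e (M + 1 - h) (M + 2) (by omega) (by omega) (by omega) (by omega)
      (by omega) (by omega)).sub ?_).mono (by omega)
    intro d hd
    simp only [stepS, if_true] at hd
    omega
  · have h2 := stepH_le q h
    have h3 : (q + h + stepH q h) % 2 = 0 := by
      unfold stepH; rw [if_neg h1]; omega
    refine ((quad_merge (q := q) (D := M + 1 - h) (g := h) (h := stepH q h) (t := t) (e := e)
      (by omega) hh h2 h3 (by omega) (by omega) (by omega)).sub ?_).mono (by omega)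
    intro d hd
    simpa [stepS, h1] using hd

lemma chain_even (q M h k : ℕ) (hq : 1 ≤ q) (hh : h ≤ 1) (hM : 1 ≤ M ∨ h = 0) :
    ∃ (S : ℕ → ℕ → Prop) (h' : ℕ), h' ≤ 1 ∧
      (∀ j, j < k → HasQuad (2 * q) (S j) (M + 2 * q * k + h' + 1)) ∧
      (∀ d, Cov (M + 2 * q * k) h' d → Cov M h d ∨ ∃ j, j < k ∧ S j d) ∧
      (q % 2 = 0 → h' = h) ∧ (q = 1 → 1 ≤ k → h' = 0) := by
  induction k with
  | zero => exact ⟨fun _ _ => False, h, hh, by simp, by simp, by simp, by simp⟩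
  | succ k ih =>
    obtain ⟨S, h', hh', h1, h2, h3, h4⟩ := ih
    have hX : 2 * q * (k + 1) = 2 * q * k + 2 * q := by ring
    set X := 2 * q * k with hXX
    have hM' : 1 ≤ M + X ∨ h' = 0 := by
      by_cases hk : k = 0
      · subst hk
        by_cases hM0 : 1 ≤ M
        · left; omega
        · right
          by_contra hne
          have hX0 : X = 0 := by simp [hXX]
          have := h2 (M + X + 1) ⟨by omega, by omega, by omega⟩
          rcases this with h | ⟨j, hj, _⟩
          · unfold Cov at h; omega
          · omega
      · left
        have : 1 ≤ q * k := Nat.mul_pos (by omega) (by omega)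
        have : X = 2 * (q * k) := by rw [hXX]; ring
        omega
    have hle := stepH_le q h'
    refine ⟨fun j => if j = k then stepS q (M + X) h' (stepH q h') else S j, stepH q h', hle,
      ?_, ?_, ?_, ?_⟩
    · intro j hj
      dsimp only
      split_ifs with hjk
      · exact (step_even hq hh' hM').mono (by omega)
      · exact (h1 j (by omega)).mono (by omega)
    · intro d hd
      rw [hX, ← add_assoc] at hd
      rcases step_cover hq hh' hM' hd with h | h
      · rcases h2 d h with h | ⟨j, hj, h⟩
        · exact Or.inl h
        · refine Or.inr ⟨j, by omega, ?_⟩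
          dsimp only
          rw [if_neg (by omega)]
          exact h
      · refine Or.inr ⟨k, by omega, ?_⟩
        dsimp only
        rw [if_pos rfl]
        exact h
    · intro hq2
      rw [← h3 hq2]
      unfold stepH
      rw [if_neg (by omega)]
      omega
    · intro hq1 _
      unfold stepH
      rw [if_pos hq1]

lemma chain_odd (q M h k τ : ℕ) (t e : ℕ → ℕ) (hh : h ≤ 1) (hM : 1 ≤ M)
    (ht : ∀ j, j < k → 0 < t j ∧ t j < e j ∧ t j ≤ τ ∧ e j + t j ≤ M + 1)
    (h0 : e 0 + t 0 < M + 1 - h ∨ (q ≤ 1 ∧ e 0 < M + 1 - h ∧ e 0 + t 0 ≠ M + 1 - h)) :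
    ∃ (S : ℕ → ℕ → Prop) (h' : ℕ), h' ≤ 1 ∧
      (∀ j, j < k → HasQuad (2 * q + 3)
        (fun d => (d = t j ∨ d = e j ∨ d = e j + t j) ∨ S j d) (M + 2 * q * k + h' + 1 + τ)) ∧
      (∀ d, Cov (M + 2 * q * k) h' d → Cov M h d ∨ ∃ j, j < k ∧ S j d) ∧
      (q % 2 = 0 → h' = h) ∧ (q = 1 → 1 ≤ k → h' = 0) := by
  rcases Nat.eq_zero_or_pos q with hq0 | hq
  · subst hq0
    refine ⟨fun _ _ => False, h, hh, ?_, by simp, by simp, by simp⟩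
    intro j hj
    obtain ⟨a1, a2, a3, a4⟩ := ht j hj
    refine ((quad_three (t j) (e j) a1 a2).sub ?_).mono (by omega)
    intro d hd
    simpa using hd
  induction k with
  | zero => exact ⟨fun _ _ => False, h, hh, by simp, by simp, by simp, by simp⟩
  | succ k ih =>
    obtain ⟨S, h', hh', h1, h2, h3, h4⟩ := ih (fun j hj => ht j (by omega))
    have hX : 2 * q * (k + 1) = 2 * q * k + 2 * q := by ring
    have hk0 : k = 0 → 2 * q * k = 0 := by rintro rfl; simp
    have hk1 : k ≠ 0 → 2 ≤ 2 * q * k := by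
      intro hk
      have : 1 ≤ q * k := Nat.mul_pos (by omega) (by omega)
      have : 2 * q * k = 2 * (q * k) := by ring
      omega
    have hk2 : k = 0 → h' ≤ h := by
      intro hk
      by_contra hlt
      have := h2 (M + 2 * q * k + 1) ⟨by omega, by omega, by omega⟩
      rcases this with h | ⟨j, hj, _⟩
      · have := hk0 hk
        unfold Cov at h; omega
      · omega
    have hk3 : k = 0 → h ≤ h' := by
      intro hk
      by_contra hlt
      have := h2 (M + 2 * q * k) ⟨by omega, by omega, by omega⟩
      rcases this with h | ⟨j, hj, _⟩
      · have := hk0 hk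
        unfold Cov at h; omega
      · omega
    set X := 2 * q * k with hXX
    have hle := stepH_le q h'
    have hM' : 1 ≤ M + X ∨ h' = 0 := by omega
    refine ⟨fun j => if j = k then stepS q (M + X) h' (stepH q h') else S j, stepH q h', hle,
      ?_, ?_, ?_, ?_⟩
    · intro j hj
      dsimp only
      split_ifs with hjk
      · subst hjk
        obtain ⟨a1, a2, a3, a4⟩ := ht j (by omega)
        refine (step_odd hq hh' hM' a1 a2 ?_).mono (by omega)
        by_cases hk : j = 0
        · have := hk2 hk
          have := hk3 hk
          have := hk0 hk
          subst hk
          omega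
        · have := hk1 hk
          left; omega
      · exact (h1 j (by omega)).mono (by omega)
    · intro d hd
      rw [hX, ← add_assoc] at hd
      rcases step_cover hq hh' hM' hd with h | h
      · rcases h2 d h with h | ⟨j, hj, h⟩
        · exact Or.inl h
        · refine Or.inr ⟨j, by omega, ?_⟩
          dsimp only
          rw [if_neg (by omega)]
          exact h
      · refine Or.inr ⟨k, by omega, ?_⟩
        dsimp only
        rw [if_pos rfl]
        exact h
    · intro hq2
      rw [← h3 hq2]
      unfold stepH
      rw [if_neg (by omega)]
      omega
    · intro hq1 _
      unfold stepH
      rw [if_pos hq1]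

/-! ### Skolem and hooked Skolem sequences -/

def IsSkolem (K h : ℕ) (a : ℕ → ℕ) : Prop :=
  (∀ t, 1 ≤ t → t ≤ K → 1 ≤ a t ∧ a t + t ≤ 2 * K + h ∧
    (h = 1 → a t ≠ 2 * K ∧ a t + t ≠ 2 * K ∧ (t < K → a t + t < 2 * K))) ∧
  ∀ x, Cov (2 * K) h x → ∃ t, 1 ≤ t ∧ t ≤ K ∧ (x = a t ∨ x = a t + t)

def skA (s t : ℕ) : ℕ :=
  if t % 2 = 0 then 6 * s - t / 2 else if t = 4 * s - 1 then 2 * s + 1 else if 2 * s + 3 ≤ t then (4 * s - 1 - t) / 2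
  else if t = 2 * s + 1 then s - 1 else if t = 2 * s - 1 then 2 * s else if t = 1 then s
  else s + 1 + (2 * s - 1 - t) / 2

set_option maxHeartbeats 1600000 in
lemma skA_spec {s : ℕ} (hs : 2 ≤ s) : IsSkolem (4 * s) 0 (skA s) := by
  refine ⟨?_, ?_⟩
  · intro t h1 h2
    unfold skA
    refine ⟨?_, ?_, fun h => absurd h (by norm_num)⟩ <;> (split_ifs <;> omega)
  · rintro x ⟨hx1, hx2, hx3⟩
    have hc : (x + 2 ≤ s)
      ∨ (x + 1 = s)
      ∨ (x = s ∨ x = s + 1)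
      ∨ (s + 2 ≤ x ∧ x + 1 ≤ 2 * s)
      ∨ (x = 2 * s)
      ∨ (x = 2 * s + 1)
      ∨ (2 * s + 2 ≤ x ∧ x + 1 ≤ 3 * s)
      ∨ (x = 3 * s)
      ∨ (3 * s + 1 ≤ x ∧ x + 2 ≤ 4 * s)
      ∨ (x + 1 = 4 * s)
      ∨ (4 * s ≤ x ∧ x + 1 ≤ 6 * s)
      ∨ (x = 6 * s)
      ∨ (6 * s + 1 ≤ x) := by omega
    rcases hc with hc | hc | hc | hc | hc | hc | hc | hc | hc | hc | hc | hc | hc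
    · obtain ⟨t, ht⟩ : ∃ t, t = 4 * s - 1 - 2 * x := ⟨_, rfl⟩
      refine ⟨t, by omega, by omega, ?_⟩
      unfold skA
      split_ifs <;> omega
    · obtain ⟨t, ht⟩ : ∃ t, t = 2 * s + 1 := ⟨_, rfl⟩
      refine ⟨t, by omega, by omega, ?_⟩
      unfold skA
      split_ifs <;> omega
    · obtain ⟨t, ht⟩ : ∃ t, t = 1 := ⟨_, rfl⟩
      refine ⟨t, by omega, by omega, ?_⟩
      unfold skA
      split_ifs <;> omega
    · obtain ⟨t, ht⟩ : ∃ t, t = 4 * s + 1 - 2 * x := ⟨_, rfl⟩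
      refine ⟨t, by omega, by omega, ?_⟩
      unfold skA
      split_ifs <;> omega
    · obtain ⟨t, ht⟩ : ∃ t, t = 2 * s - 1 := ⟨_, rfl⟩
      refine ⟨t, by omega, by omega, ?_⟩
      unfold skA
      split_ifs <;> omega
    · obtain ⟨t, ht⟩ : ∃ t, t = 4 * s - 1 := ⟨_, rfl⟩
      refine ⟨t, by omega, by omega, ?_⟩
      unfold skA
      split_ifs <;> omega
    · obtain ⟨t, ht⟩ : ∃ t, t = 2 * x - 4 * s - 1 := ⟨_, rfl⟩
      refine ⟨t, by omega, by omega, ?_⟩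
      unfold skA
      split_ifs <;> omega
    · obtain ⟨t, ht⟩ : ∃ t, t = 2 * s + 1 := ⟨_, rfl⟩
      refine ⟨t, by omega, by omega, ?_⟩
      unfold skA
      split_ifs <;> omega
    · obtain ⟨t, ht⟩ : ∃ t, t = 2 * x + 1 - 4 * s := ⟨_, rfl⟩
      refine ⟨t, by omega, by omega, ?_⟩
      unfold skA
      split_ifs <;> omega
    · obtain ⟨t, ht⟩ : ∃ t, t = 2 * s - 1 := ⟨_, rfl⟩
      refine ⟨t, by omega, by omega, ?_⟩
      unfold skA
      split_ifs <;> omega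
    · obtain ⟨t, ht⟩ : ∃ t, t = 12 * s - 2 * x := ⟨_, rfl⟩
      refine ⟨t, by omega, by omega, ?_⟩
      unfold skA
      split_ifs <;> omega
    · obtain ⟨t, ht⟩ : ∃ t, t = 4 * s - 1 := ⟨_, rfl⟩
      refine ⟨t, by omega, by omega, ?_⟩
      unfold skA
      split_ifs <;> omega
    · obtain ⟨t, ht⟩ : ∃ t, t = 2 * x - 12 * s := ⟨_, rfl⟩
      refine ⟨t, by omega, by omega, ?_⟩
      unfold skA
      split_ifs <;> omega

def skB (s t : ℕ) : ℕ :=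
  if t % 2 = 0 then 6 * s + 2 - t / 2 else if t = 4 * s + 1 then 2 * s + 1 else if 2 * s + 1 ≤ t then (4 * s + 1 - t) / 2
  else if t = 2 * s - 1 then 2 * s + 2 else if t = 1 then s + 1
  else s + 2 + (2 * s - 1 - t) / 2

set_option maxHeartbeats 1600000 in
lemma skB_spec {s : ℕ} (hs : 2 ≤ s) : IsSkolem (4 * s + 1) 0 (skB s) := by
  refine ⟨?_, ?_⟩
  · intro t h1 h2
    unfold skB
    refine ⟨?_, ?_, fun h => absurd h (by norm_num)⟩ <;> (split_ifs <;> omega)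
  · rintro x ⟨hx1, hx2, hx3⟩
    have hc : (x ≤ s)
      ∨ (x = s + 1 ∨ x = s + 2)
      ∨ (s + 3 ≤ x ∧ x ≤ 2 * s)
      ∨ (x = 2 * s + 1)
      ∨ (x = 2 * s + 2)
      ∨ (2 * s + 3 ≤ x ∧ x ≤ 3 * s)
      ∨ (3 * s + 1 ≤ x ∧ x ≤ 4 * s)
      ∨ (x = 4 * s + 1)
      ∨ (4 * s + 2 ≤ x ∧ x ≤ 6 * s + 1)
      ∨ (x = 6 * s + 2)
      ∨ (6 * s + 3 ≤ x) := by omega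
    rcases hc with hc | hc | hc | hc | hc | hc | hc | hc | hc | hc | hc
    · obtain ⟨t, ht⟩ : ∃ t, t = 4 * s + 1 - 2 * x := ⟨_, rfl⟩
      refine ⟨t, by omega, by omega, ?_⟩
      unfold skB
      split_ifs <;> omega
    · obtain ⟨t, ht⟩ : ∃ t, t = 1 := ⟨_, rfl⟩
      refine ⟨t, by omega, by omega, ?_⟩
      unfold skB
      split_ifs <;> omega
    · obtain ⟨t, ht⟩ : ∃ t, t = 4 * s + 3 - 2 * x := ⟨_, rfl⟩
      refine ⟨t, by omega, by omega, ?_⟩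
      unfold skB
      split_ifs <;> omega
    · obtain ⟨t, ht⟩ : ∃ t, t = 4 * s + 1 := ⟨_, rfl⟩
      refine ⟨t, by omega, by omega, ?_⟩
      unfold skB
      split_ifs <;> omega
    · obtain ⟨t, ht⟩ : ∃ t, t = 2 * s - 1 := ⟨_, rfl⟩
      refine ⟨t, by omega, by omega, ?_⟩
      unfold skB
      split_ifs <;> omega
    · obtain ⟨t, ht⟩ : ∃ t, t = 2 * x - 4 * s - 3 := ⟨_, rfl⟩
      refine ⟨t, by omega, by omega, ?_⟩
      unfold skB
      split_ifs <;> omega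
    · obtain ⟨t, ht⟩ : ∃ t, t = 2 * x - 4 * s - 1 := ⟨_, rfl⟩
      refine ⟨t, by omega, by omega, ?_⟩
      unfold skB
      split_ifs <;> omega
    · obtain ⟨t, ht⟩ : ∃ t, t = 2 * s - 1 := ⟨_, rfl⟩
      refine ⟨t, by omega, by omega, ?_⟩
      unfold skB
      split_ifs <;> omega
    · obtain ⟨t, ht⟩ : ∃ t, t = 12 * s + 4 - 2 * x := ⟨_, rfl⟩
      refine ⟨t, by omega, by omega, ?_⟩
      unfold skB
      split_ifs <;> omega
    · obtain ⟨t, ht⟩ : ∃ t, t = 4 * s + 1 := ⟨_, rfl⟩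
      refine ⟨t, by omega, by omega, ?_⟩
      unfold skB
      split_ifs <;> omega
    · obtain ⟨t, ht⟩ : ∃ t, t = 2 * x - 12 * s - 4 := ⟨_, rfl⟩
      refine ⟨t, by omega, by omega, ?_⟩
      unfold skB
      split_ifs <;> omega

def skC (s t : ℕ) : ℕ :=
  if t = 4 * s + 2 then 4 * s + 3 else if t % 2 = 0 then (4 * s + 2 - t) / 2 else if t = 4 * s + 1 then 2 * s + 1
  else if 2 * s + 3 ≤ t then 4 * s + 3 + (4 * s + 1 - t) / 2 else if t = 2 * s + 1 then 4 * s + 2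
  else if t = 1 then 7 * s + 3 else 5 * s + 2 + (2 * s + 1 - t) / 2

set_option maxHeartbeats 1600000 in
lemma skC_spec {s : ℕ} (hs : 1 ≤ s) : IsSkolem (4 * s + 2) 1 (skC s) := by
  refine ⟨?_, ?_⟩
  · intro t h1 h2
    unfold skC
    refine ⟨?_, ?_, fun _ => ⟨?_, ?_, fun _ => ?_⟩⟩ <;> (split_ifs <;> omega)
  · rintro x ⟨hx1, hx2, hx3⟩
    have hc : (x ≤ 2 * s)
      ∨ (x = 2 * s + 1)
      ∨ (2 * s + 2 ≤ x ∧ x ≤ 4 * s + 1)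
      ∨ (x = 4 * s + 2)
      ∨ (x = 4 * s + 3)
      ∨ (4 * s + 4 ≤ x ∧ x ≤ 5 * s + 2)
      ∨ (5 * s + 3 ≤ x ∧ x ≤ 6 * s + 1)
      ∨ (x = 6 * s + 2)
      ∨ (x = 6 * s + 3)
      ∨ (6 * s + 4 ≤ x ∧ x ≤ 7 * s + 2)
      ∨ (x = 7 * s + 3 ∨ x = 7 * s + 4)
      ∨ (7 * s + 5 ≤ x ∧ x ≤ 8 * s + 3)
      ∨ (x = 8 * s + 5) := by omega
    rcases hc with hc | hc | hc | hc | hc | hc | hc | hc | hc | hc | hc | hc | hc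
    · obtain ⟨t, ht⟩ : ∃ t, t = 4 * s + 2 - 2 * x := ⟨_, rfl⟩
      refine ⟨t, by omega, by omega, ?_⟩
      unfold skC
      split_ifs <;> omega
    · obtain ⟨t, ht⟩ : ∃ t, t = 4 * s + 1 := ⟨_, rfl⟩
      refine ⟨t, by omega, by omega, ?_⟩
      unfold skC
      split_ifs <;> omega
    · obtain ⟨t, ht⟩ : ∃ t, t = 2 * x - 4 * s - 2 := ⟨_, rfl⟩
      refine ⟨t, by omega, by omega, ?_⟩
      unfold skC
      split_ifs <;> omega
    · obtain ⟨t, ht⟩ : ∃ t, t = 2 * s + 1 := ⟨_, rfl⟩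
      refine ⟨t, by omega, by omega, ?_⟩
      unfold skC
      split_ifs <;> omega
    · obtain ⟨t, ht⟩ : ∃ t, t = 4 * s + 2 := ⟨_, rfl⟩
      refine ⟨t, by omega, by omega, ?_⟩
      unfold skC
      split_ifs <;> omega
    · obtain ⟨t, ht⟩ : ∃ t, t = 12 * s + 7 - 2 * x := ⟨_, rfl⟩
      refine ⟨t, by omega, by omega, ?_⟩
      unfold skC
      split_ifs <;> omega
    · obtain ⟨t, ht⟩ : ∃ t, t = 12 * s + 5 - 2 * x := ⟨_, rfl⟩
      refine ⟨t, by omega, by omega, ?_⟩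
      unfold skC
      split_ifs <;> omega
    · obtain ⟨t, ht⟩ : ∃ t, t = 4 * s + 1 := ⟨_, rfl⟩
      refine ⟨t, by omega, by omega, ?_⟩
      unfold skC
      split_ifs <;> omega
    · obtain ⟨t, ht⟩ : ∃ t, t = 2 * s + 1 := ⟨_, rfl⟩
      refine ⟨t, by omega, by omega, ?_⟩
      unfold skC
      split_ifs <;> omega
    · obtain ⟨t, ht⟩ : ∃ t, t = 2 * x - 12 * s - 5 := ⟨_, rfl⟩
      refine ⟨t, by omega, by omega, ?_⟩
      unfold skC
      split_ifs <;> omega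
    · obtain ⟨t, ht⟩ : ∃ t, t = 1 := ⟨_, rfl⟩
      refine ⟨t, by omega, by omega, ?_⟩
      unfold skC
      split_ifs <;> omega
    · obtain ⟨t, ht⟩ : ∃ t, t = 2 * x - 12 * s - 7 := ⟨_, rfl⟩
      refine ⟨t, by omega, by omega, ?_⟩
      unfold skC
      split_ifs <;> omega
    · obtain ⟨t, ht⟩ : ∃ t, t = 4 * s + 2 := ⟨_, rfl⟩
      refine ⟨t, by omega, by omega, ?_⟩
      unfold skC
      split_ifs <;> omega

def skD (s t : ℕ) : ℕ :=
  if t = 4 * s - 2 then 2 * s + 1 else if t % 2 = 0 then 4 * s + (4 * s - 2 - t) / 2 else if t = 4 * s - 1 then 4 * s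
  else if 2 * s + 3 ≤ t then (4 * s - 1 - t) / 2 else if t = 2 * s + 1 then s - 1 else if t = 2 * s - 1 then 2 * s
  else if t = 1 then s else s + 1 + (2 * s - 1 - t) / 2

set_option maxHeartbeats 1600000 in
lemma skD_spec {s : ℕ} (hs : 2 ≤ s) : IsSkolem (4 * s - 1) 1 (skD s) := by
  refine ⟨?_, ?_⟩
  · intro t h1 h2
    unfold skD
    refine ⟨?_, ?_, fun _ => ⟨?_, ?_, fun _ => ?_⟩⟩ <;> (split_ifs <;> omega)
  · rintro x ⟨hx1, hx2, hx3⟩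
    have hc : (x + 2 ≤ s)
      ∨ (x + 1 = s)
      ∨ (x = s ∨ x = s + 1)
      ∨ (s + 2 ≤ x ∧ x + 1 ≤ 2 * s)
      ∨ (x = 2 * s)
      ∨ (x = 2 * s + 1)
      ∨ (2 * s + 2 ≤ x ∧ x + 1 ≤ 3 * s)
      ∨ (x = 3 * s)
      ∨ (3 * s + 1 ≤ x ∧ x + 2 ≤ 4 * s)
      ∨ (x + 1 = 4 * s)
      ∨ (x = 4 * s ∨ x + 1 = 8 * s)
      ∨ (4 * s + 1 ≤ x ∧ x + 2 ≤ 6 * s)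
      ∨ (x + 1 = 6 * s)
      ∨ (6 * s ≤ x ∧ x + 3 ≤ 8 * s) := by omega
    rcases hc with hc | hc | hc | hc | hc | hc | hc | hc | hc | hc | hc | hc | hc | hc
    · obtain ⟨t, ht⟩ : ∃ t, t = 4 * s - 1 - 2 * x := ⟨_, rfl⟩
      refine ⟨t, by omega, by omega, ?_⟩
      unfold skD
      split_ifs <;> omega
    · obtain ⟨t, ht⟩ : ∃ t, t = 2 * s + 1 := ⟨_, rfl⟩
      refine ⟨t, by omega, by omega, ?_⟩
      unfold skD
      split_ifs <;> omega
    · obtain ⟨t, ht⟩ : ∃ t, t = 1 := ⟨_, rfl⟩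
      refine ⟨t, by omega, by omega, ?_⟩
      unfold skD
      split_ifs <;> omega
    · obtain ⟨t, ht⟩ : ∃ t, t = 4 * s + 1 - 2 * x := ⟨_, rfl⟩
      refine ⟨t, by omega, by omega, ?_⟩
      unfold skD
      split_ifs <;> omega
    · obtain ⟨t, ht⟩ : ∃ t, t = 2 * s - 1 := ⟨_, rfl⟩
      refine ⟨t, by omega, by omega, ?_⟩
      unfold skD
      split_ifs <;> omega
    · obtain ⟨t, ht⟩ : ∃ t, t = 4 * s - 2 := ⟨_, rfl⟩
      refine ⟨t, by omega, by omega, ?_⟩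
      unfold skD
      split_ifs <;> omega
    · obtain ⟨t, ht⟩ : ∃ t, t = 2 * x - 4 * s - 1 := ⟨_, rfl⟩
      refine ⟨t, by omega, by omega, ?_⟩
      unfold skD
      split_ifs <;> omega
    · obtain ⟨t, ht⟩ : ∃ t, t = 2 * s + 1 := ⟨_, rfl⟩
      refine ⟨t, by omega, by omega, ?_⟩
      unfold skD
      split_ifs <;> omega
    · obtain ⟨t, ht⟩ : ∃ t, t = 2 * x + 1 - 4 * s := ⟨_, rfl⟩
      refine ⟨t, by omega, by omega, ?_⟩
      unfold skD
      split_ifs <;> omega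
    · obtain ⟨t, ht⟩ : ∃ t, t = 2 * s - 1 := ⟨_, rfl⟩
      refine ⟨t, by omega, by omega, ?_⟩
      unfold skD
      split_ifs <;> omega
    · obtain ⟨t, ht⟩ : ∃ t, t = 4 * s - 1 := ⟨_, rfl⟩
      refine ⟨t, by omega, by omega, ?_⟩
      unfold skD
      split_ifs <;> omega
    · obtain ⟨t, ht⟩ : ∃ t, t = 12 * s - 2 - 2 * x := ⟨_, rfl⟩
      refine ⟨t, by omega, by omega, ?_⟩
      unfold skD
      split_ifs <;> omega
    · obtain ⟨t, ht⟩ : ∃ t, t = 4 * s - 2 := ⟨_, rfl⟩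
      refine ⟨t, by omega, by omega, ?_⟩
      unfold skD
      split_ifs <;> omega
    · obtain ⟨t, ht⟩ : ∃ t, t = 2 * x + 2 - 12 * s := ⟨_, rfl⟩
      refine ⟨t, by omega, by omega, ?_⟩
      unfold skD
      split_ifs <;> omega

def skSmall (K t : ℕ) : ℕ :=
  if K = 1 then 1
  else if K = 2 then (if t = 1 then 1 else 3)
  else if K = 3 then (if t = 1 then 1 else if t = 2 then 3 else 4)
  else if K = 4 then (if t = 1 then 1 else if t = 2 then 4 else if t = 3 then 5 else 3)
  else (if t = 1 then 8 else if t = 2 then 1 else if t = 3 then 4 else if t = 4 then 2 else 5)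

lemma skSmall_aux1 : ∀ K, 1 ≤ K → K ≤ 5 → ∀ t, 1 ≤ t → t ≤ K →
    1 ≤ skSmall K t ∧ skSmall K t + t ≤ 2 * K + (if K % 4 ≤ 1 then 0 else 1) ∧
    ((if K % 4 ≤ 1 then 0 else 1) = 1 →
      skSmall K t ≠ 2 * K ∧ skSmall K t + t ≠ 2 * K ∧ (t < K → skSmall K t + t < 2 * K)) := by
  intro K h1 h2 t h3 h4
  interval_cases K <;> interval_cases t <;> decide

lemma skSmall_aux2 : ∀ K, 1 ≤ K → K ≤ 5 → ∀ x, Cov (2 * K) (if K % 4 ≤ 1 then 0 else 1) x →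
    ∃ t, 1 ≤ t ∧ t ≤ K ∧ (x = skSmall K t ∨ x = skSmall K t + t) := by
  intro K h1 h2 x hx
  have hd : ∀ K : Fin 6, 1 ≤ K.val → ∀ x : Fin 12, (1 ≤ x.val ∧
      x.val ≤ 2 * K.val + (if K.val % 4 ≤ 1 then 0 else 1) ∧
      ((if K.val % 4 ≤ 1 then 0 else 1) = 0 ∨ x.val ≠ 2 * K.val)) →
      ∃ t : Fin 6, 1 ≤ t.val ∧ t.val ≤ K.val ∧
        (x.val = skSmall K.val t.val ∨ x.val = skSmall K.val t.val + t.val) := by decide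
  have hx' := hx
  unfold Cov at hx'
  obtain ⟨t, h⟩ := hd ⟨K, by omega⟩ h1 ⟨x, by split_ifs at hx' <;> omega⟩ hx'
  exact ⟨t.val, h⟩

lemma exists_skolem (K : ℕ) (hK : 1 ≤ K) :
    ∃ a, IsSkolem K (if K % 4 ≤ 1 then 0 else 1) a := by
  by_cases h5 : K ≤ 5
  · exact ⟨skSmall K, skSmall_aux1 K hK h5, skSmall_aux2 K hK h5⟩
  have h4 : K % 4 < 4 := Nat.mod_lt _ (by norm_num)
  by_cases h0 : K % 4 = 0
  · refine ⟨skA (K / 4), ?_⟩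
    rw [if_pos (by omega)]
    have := skA_spec (s := K / 4) (by omega)
    rwa [show 4 * (K / 4) = K by omega] at this
  by_cases h1 : K % 4 = 1
  · refine ⟨skB (K / 4), ?_⟩
    rw [if_pos (by omega)]
    have := skB_spec (s := K / 4) (by omega)
    rwa [show 4 * (K / 4) + 1 = K by omega] at this
  by_cases h2 : K % 4 = 2
  · refine ⟨skC (K / 4), ?_⟩
    rw [if_neg (by omega)]
    have := skC_spec (s := K / 4) (by omega)
    rwa [show 4 * (K / 4) + 2 = K by omega] at this
  · refine ⟨skD (K / 4 + 1), ?_⟩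
    rw [if_neg (by omega)]
    have := skD_spec (s := K / 4 + 1) (by omega)
    rwa [show 4 * (K / 4 + 1) - 1 = K by omega] at this

lemma skolem_triples (K : ℕ) (hK : 1 ≤ K) :
    ∃ (h : ℕ) (e : ℕ → ℕ), h ≤ 1 ∧ (K % 4 ≤ 1 → h = 0) ∧
      (∀ t, 1 ≤ t → t ≤ K → K < e t ∧ e t + t ≤ 3 * K + h ∧
        (h = 1 → e t ≠ 3 * K ∧ e t + t ≠ 3 * K ∧ (t < K → e t + t < 3 * K))) ∧
      (∀ d, Cov (3 * K) h d → ∃ t, 1 ≤ t ∧ t ≤ K ∧ (d = t ∨ d = e t ∨ d = e t + t)) := by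
  obtain ⟨a, ha, hb⟩ := exists_skolem K hK
  refine ⟨if K % 4 ≤ 1 then 0 else 1, fun t => K + a t, by split_ifs <;> omega,
    fun h => if_pos h, ?_, ?_⟩
  · intro t h1 h2
    have := ha t h1 h2
    dsimp only
    omega
  · intro d hd
    by_cases hdK : d ≤ K
    · exact ⟨d, hd.1, hdK, Or.inl rfl⟩
    · obtain ⟨t, h1, h2, h3⟩ := hb (d - K) (by unfold Cov at *; omega)
      refine ⟨t, h1, h2, ?_⟩
      dsimp only
      omega

/-! ### Reduction to starters -/

lemma fin2_add_two (a : Fin 2) : a + 1 + 1 = a := by revert a; decide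

lemma half_succ {l : ℕ} (hl : 1 ≤ l) (j : ZMod (2 * l)) :
    (j + 1).val = if j.val + 1 = 2 * l then 0 else j.val + 1 := by
  have : NeZero (2 * l) := ⟨by omega⟩
  have : Fact (1 < 2 * l) := ⟨by omega⟩
  have hj := ZMod.val_lt j
  rw [ZMod.val_add, ZMod.val_one, nxt_eq hj]

lemma mkFactor {n s t : ℕ} {m : Fin t → ℕ} (hm : ∀ i, 2 ≤ m i) (hn : n = s + ∑ i, m i)
    (c : Fin t → ℕ → Fin n) (x : Fin t → ℕ → Fin 2)
    (hinj : ∀ i i' r r', r < m i → r' < m i' → c i r = c i' r' → i = i' ∧ r = r') :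
    ∃ F : HOPFactor n s t m, ∀ e, ¬ IsIEdge e → (e ∈ F.edges ↔ ∃ i r, r < m i ∧
      e = s((c i r, x i r), (c i ((r + 1) % m i), x i ((r + 1) % m i) + 1))) := by
  classical
  let ι : (Σ i : Fin t, Fin (m i)) → Fin n := fun z => c z.1 z.2
  have hι : Function.Injective ι := by
    rintro ⟨i, r⟩ ⟨i', r'⟩ h
    obtain ⟨h1, h2⟩ := hinj i i' r r' r.2 r'.2 h
    subst h1
    have : r = r' := Fin.ext h2
    rw [this]
  have hcard : Fintype.card {u : Fin n // u ∉ Set.range ι} = s := by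
    have h1 := Fintype.card_subtype_compl (fun u : Fin n => u ∈ Set.range ι)
    have h2 : Fintype.card {u : Fin n // u ∈ Set.range ι} = ∑ i, m i := by
      rw [← Fintype.card_congr (Equiv.ofInjective ι hι)]
      simp
    rw [h1, h2, Fintype.card_fin]
    omega
  let ψ : Fin s ≃ {u : Fin n // u ∉ Set.range ι} := (Fintype.equivFinOfCardEq hcard).symm
  let cy : (i : Fin t) → ZMod (2 * m i) → HOPVertex n := fun i j =>
    (c i (j.val / 2), if j.val % 2 = 0 then x i (j.val / 2) + 1 else x i (j.val / 2))
  have hval : ∀ i (j : ZMod (2 * m i)), j.val < 2 * m i := by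
    intro i j
    have : NeZero (2 * m i) := ⟨by have := hm i; omega⟩
    exact ZMod.val_lt j
  have hev : ∀ i (j : ZMod (2 * m i)), j.val % 2 = 0 → cy i (j + 1) = HOPspouse (cy i j) := by
    intro i j h0
    have h1 := half_succ (by have := hm i; omega) j
    have h2 := hval i j
    rw [if_neg (by omega)] at h1
    have h3 : (j + 1).val / 2 = j.val / 2 := by omega
    simp only [cy, HOPspouse, h3]
    rw [if_neg (by omega), if_pos h0, fin2_add_two]
  have hod : ∀ i (j : ZMod (2 * m i)), j.val % 2 = 1 →
      cy i j = (c i (j.val / 2), x i (j.val / 2)) ∧ cy i (j + 1) =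
        (c i ((j.val / 2 + 1) % m i), x i ((j.val / 2 + 1) % m i) + 1) := by
    intro i j h0
    have h1 := half_succ (by have := hm i; omega) j
    have h2 := hval i j
    have h3 : (j + 1).val / 2 = (j.val / 2 + 1) % m i := by
      rw [nxt_eq (by omega), h1]
      split_ifs <;> omega
    have h4 : (j + 1).val % 2 = 0 := by
      rw [h1]; split_ifs <;> omega
    simp only [cy, h3]
    rw [if_neg (by omega), if_pos h4]
    exact ⟨rfl, rfl⟩
  have hne : ∀ i r, r < m i → c i r ≠ c i ((r + 1) % m i) := by
    intro i r hr h
    have h2 := hm i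
    have := (hinj i i r _ hr (Nat.mod_lt _ (by omega)) h).2
    rw [nxt_eq hr] at this
    split_ifs at this <;> omega
  let F : HOPFactor n s t m :=
    { pair := fun a => ((ψ a).1, 0)
      cyc := cy
      alt_even := hev
      alt_odd := by
        intro i j h0 ⟨v, hv⟩
        obtain ⟨h1, h2⟩ := hod i j h0
        rw [h1, h2] at hv
        have := hne i (j.val / 2) (by have := hval i j; omega)
        apply this
        rw [Sym2.eq_iff] at hv
        rcases hv with ⟨hv1, hv2⟩ | ⟨hv1, hv2⟩
        · have e1 := congrArg Prod.fst hv1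
          have e2 := congrArg Prod.fst hv2
          simp only [HOPspouse] at e1 e2
          rw [e1, e2]
        · have e1 := congrArg Prod.fst hv1
          have e2 := congrArg Prod.fst hv2
          simp only [HOPspouse] at e1 e2
          rw [e1, e2]
      spanning := by
        constructor
        · rintro (⟨a, y⟩ | ⟨i, j⟩) (⟨a', y'⟩ | ⟨i', j'⟩) h
          · simp only [Sum.elim_inl] at h
            have h1 := congrArg Prod.fst h
            have h2 := congrArg Prod.snd h
            have h3 : (ψ a).1 = (ψ a').1 := by
              simpa [HOPspouse, apply_ite Prod.fst] using h1
            have h4 : a = a' := ψ.injective (Subtype.ext h3)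
            have h5 : y = y' := by
              revert h2
              simp only [HOPspouse, apply_ite Prod.snd]
              clear h h1
              revert y y'; decide
            rw [h4, h5]
          · exfalso
            simp only [Sum.elim_inl, Sum.elim_inr] at h
            have h1 := congrArg Prod.fst h
            have h3 : (ψ a).1 = c i' (j'.val / 2) := by
              simpa [HOPspouse, apply_ite Prod.fst, cy] using h1
            exact (ψ a).2 ⟨⟨i', ⟨j'.val / 2, by have := hval i' j'; omega⟩⟩, h3.symm⟩
          · exfalso
            simp only [Sum.elim_inl, Sum.elim_inr] at h
            have h1 := congrArg Prod.fst h.symm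
            have h3 : (ψ a').1 = c i (j.val / 2) := by
              simpa [HOPspouse, apply_ite Prod.fst, cy] using h1
            exact (ψ a').2 ⟨⟨i, ⟨j.val / 2, by have := hval i j; omega⟩⟩, h3.symm⟩
          · simp only [Sum.elim_inr, cy] at h
            have h1 := congrArg Prod.fst h
            have h2 := congrArg Prod.snd h
            simp only at h1 h2
            have b1 := hval i j
            have b2 := hval i' j'
            obtain ⟨h3, h4⟩ := hinj i i' _ _ (by omega) (by omega) h1
            subst h3
            rw [h4] at h2
            have h5 : j.val % 2 = j'.val % 2 := by
              have hz : ∀ z : Fin 2, z + 1 ≠ z := by decide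
              split_ifs at h2 with q1 q2 q2
              · omega
              · exact absurd h2 (hz _)
              · exact absurd h2.symm (hz _)
              · omega
            have : NeZero (2 * m i) := ⟨by have := hm i; omega⟩
            have h6 : j = j' := ZMod.val_injective _ (by omega)
            rw [h6]
        · rintro ⟨u, y⟩
          by_cases hu : u ∈ Set.range ι
          · obtain ⟨⟨i, r⟩, hr⟩ := hu
            have hr2 := r.2
            have : NeZero (2 * m i) := ⟨by omega⟩
            by_cases hy : y = x i r
            · refine ⟨Sum.inr ⟨i, ((2 * r.val + 1 : ℕ) : ZMod (2 * m i))⟩, ?_⟩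
              have hv : ((2 * r.val + 1 : ℕ) : ZMod (2 * m i)).val = 2 * r.val + 1 :=
                ZMod.val_natCast_of_lt (by omega)
              simp only [Sum.elim_inr, cy, hv]
              rw [if_neg (by omega), show (2 * r.val + 1) / 2 = r.val by omega, hy, ← hr]
            · refine ⟨Sum.inr ⟨i, ((2 * r.val : ℕ) : ZMod (2 * m i))⟩, ?_⟩
              have hv : ((2 * r.val : ℕ) : ZMod (2 * m i)).val = 2 * r.val :=
                ZMod.val_natCast_of_lt (by omega)
              simp only [Sum.elim_inr, cy, hv]
              have hz : ∀ z w : Fin 2, z ≠ w → w + 1 = z := by decide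
              rw [if_pos (by omega), show (2 * r.val) / 2 = r.val by omega, hz _ _ hy, ← hr]
          · refine ⟨Sum.inl (ψ.symm ⟨u, hu⟩, y), ?_⟩
            simp only [Sum.elim_inl, Equiv.apply_symm_apply, HOPspouse]
            have hz : ∀ z : Fin 2, (z = 0 ∧ (0 : Fin 2) = z) ∨ (z ≠ 0 ∧ (0 : Fin 2) + 1 = z) := by
              decide
            rcases hz y with ⟨h1, h2⟩ | ⟨h1, h2⟩
            · rw [if_pos h1, h1]
            · rw [if_neg h1, h2] }
  refine ⟨F, fun e he => ⟨?_, ?_⟩⟩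
  · rintro (⟨a, ha⟩ | ⟨i, j, hj⟩)
    · exact absurd ⟨_, ha⟩ he
    · by_cases h0 : j.val % 2 = 0
      · exfalso
        apply he
        refine ⟨cy i j, ?_⟩
        rw [hj, ← hev i j h0]
      · obtain ⟨h1, h2⟩ := hod i j (by omega)
        refine ⟨i, j.val / 2, by have := hval i j; omega, ?_⟩
        rw [hj, ← h1, ← h2]
  · rintro ⟨i, r, hr, h⟩
    right
    have : NeZero (2 * m i) := ⟨by omega⟩
    have hv : ((2 * r + 1 : ℕ) : ZMod (2 * m i)).val = 2 * r + 1 :=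
      ZMod.val_natCast_of_lt (by omega)
    refine ⟨i, ((2 * r + 1 : ℕ) : ZMod (2 * m i)), ?_⟩
    obtain ⟨h1, h2⟩ := hod i ((2 * r + 1 : ℕ) : ZMod (2 * m i)) (by omega)
    rw [hv, show (2 * r + 1) / 2 = r by omega] at h1 h2
    change e = s(cy i _, cy i _)
    rw [h1, h2, h]

theorem reduction {n s t k μ : ℕ} {m : Fin t → ℕ} (hm : ∀ i, 2 ≤ m i) (hμ : μ = ∑ i, m i)
    (hns : n = s + μ) (hn : n = 2 * (μ * k) + 1)
    (f : Fin k × Fin 4 → Fin t → ℕ → ZMod n) (x : Fin k × Fin 4 → Fin t → ℕ → Fin 2)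
    (hinj : ∀ p i i' r r', r < m i → r' < m i' → f p i r = f p i' r' → i = i' ∧ r = r')
    (hcov : ∀ d : ZMod n, d ≠ 0 → ∀ a b : Fin 2, ∃ p i r, r < m i ∧
      ((f p i ((r + 1) % m i) - f p i r = d ∧ x p i r = a ∧ x p i ((r + 1) % m i) + 1 = b) ∨
       (f p i r - f p i ((r + 1) % m i) = d ∧ x p i r = b ∧ x p i ((r + 1) % m i) + 1 = a))) :
    HOPSolution n s t m := by
  classical
  have : NeZero n := ⟨by omega⟩
  let φ : ZMod n ≃ Fin n := (ZMod.finEquiv n).symm.toEquiv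
  have hF := fun (z : (Fin k × Fin 4) × ZMod n) =>
    mkFactor hm (hμ ▸ hns) (fun i r => φ (f z.1 i r + z.2)) (x z.1) (by
      intro i i' r r' h1 h2 h3
      have := φ.injective h3
      exact hinj z.1 i i' r r' h1 h2 (add_right_cancel this))
  choose F hF using hF
  have hne : ∀ p i r, r < m i → f p i ((r + 1) % m i) - f p i r ≠ 0 := by
    intro p i r hr h
    have h2 := hm i
    have := (hinj p i i _ r (Nat.mod_lt _ (by omega)) hr (sub_eq_zero.mp h)).2
    rw [nxt_eq hr] at this
    split_ifs at this <;> omega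
  -- the label map
  let L : (Fin k × Fin 4) × (Σ i : Fin t, Fin (m i)) × Bool →
      {d : ZMod n // d ≠ 0} × Fin 2 × Fin 2 := fun z =>
    if z.2.2 then
      (⟨f z.1 z.2.1.1 ((z.2.1.2.val + 1) % m z.2.1.1) - f z.1 z.2.1.1 z.2.1.2.val,
        hne _ _ _ z.2.1.2.2⟩, x z.1 z.2.1.1 z.2.1.2.val,
        x z.1 z.2.1.1 ((z.2.1.2.val + 1) % m z.2.1.1) + 1)
    else
      (⟨f z.1 z.2.1.1 z.2.1.2.val - f z.1 z.2.1.1 ((z.2.1.2.val + 1) % m z.2.1.1), by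
          have := hne z.1 z.2.1.1 z.2.1.2.val z.2.1.2.2
          rw [← neg_sub]
          exact neg_ne_zero.mpr this⟩,
        x z.1 z.2.1.1 ((z.2.1.2.val + 1) % m z.2.1.1) + 1, x z.1 z.2.1.1 z.2.1.2.val)
  have hLs : Function.Surjective L := by
    rintro ⟨⟨d, hd⟩, a, b⟩
    obtain ⟨p, i, r, hr, ⟨h1, h2, h3⟩ | ⟨h1, h2, h3⟩⟩ := hcov d hd a b
    · refine ⟨(p, ⟨i, ⟨r, hr⟩⟩, true), ?_⟩
      simp [L, h1, h2, h3]
    · refine ⟨(p, ⟨i, ⟨r, hr⟩⟩, false), ?_⟩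
      simp [L, h1, h2, h3]
  have hc : Fintype.card {d : ZMod n // d ≠ 0} = n - 1 := by
    rw [Fintype.card_subtype_compl]
    simp [ZMod.card]
  have hLb : Function.Bijective L := by
    rw [Fintype.bijective_iff_surjective_and_card]
    refine ⟨hLs, ?_⟩
    simp only [Fintype.card_prod, Fintype.card_fin, Fintype.card_sigma, Fintype.card_bool, hc]
    rw [← hμ, hn]
    simp only [Nat.add_sub_cancel]
    ring
  have hLi := hLb.1
  have hγ : Fintype.card ((Fin k × Fin 4) × ZMod n) = 4 * k * n := by
    simp only [Fintype.card_prod, Fintype.card_fin, ZMod.card]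
    ring
  let E : Fin (4 * k * n) ≃ (Fin k × Fin 4) × ZMod n := (Fintype.equivFinOfCardEq hγ).symm
  refine ⟨4 * k * n, ?_, fun γ => F (E γ), ?_⟩
  · rw [← hμ]
    have : n - 1 = 2 * (μ * k) := by omega
    rw [this]
    ring
  suffices H : ∀ e : Sym2 (HOPVertex n), ¬ e.IsDiag → ¬ IsIEdge e → ∃! z, e ∈ (F z).edges by
    intro e h1 h2
    obtain ⟨z, hz, hu⟩ := H e h1 h2
    refine ⟨E.symm z, by simpa using hz, ?_⟩
    intro y hy
    rw [← hu (E y) hy]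
    simp
  intro e
  induction e using Sym2.ind with
  | _ v w =>
  obtain ⟨u, a⟩ := v
  obtain ⟨v, b⟩ := w
  intro hd hI
  have huv : u ≠ v := by
    rintro rfl
    have hab : a ≠ b := by
      rintro rfl
      exact hd rfl
    apply hI
    refine ⟨(u, a), ?_⟩
    have hz : ∀ a b : Fin 2, a ≠ b → b = a + 1 := by decide
    simp only [HOPspouse]
    rw [← hz a b hab]
  obtain ⟨U, rfl⟩ := φ.surjective u
  obtain ⟨V, rfl⟩ := φ.surjective v
  have hUV : V - U ≠ 0 := by
    intro h
    exact huv (by rw [sub_eq_zero.mp h])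
  have hmem : ∀ z, s((φ U, a), (φ V, b)) ∈ (F z).edges ↔ ∃ i r, r < m i ∧
      ((f z.1 i r + z.2 = U ∧ x z.1 i r = a ∧ f z.1 i ((r + 1) % m i) + z.2 = V ∧
        x z.1 i ((r + 1) % m i) + 1 = b) ∨
       (f z.1 i r + z.2 = V ∧ x z.1 i r = b ∧ f z.1 i ((r + 1) % m i) + z.2 = U ∧
        x z.1 i ((r + 1) % m i) + 1 = a)) := by
    intro z
    rw [hF z _ hI]
    refine exists_congr fun i => exists_congr fun r => and_congr_right fun _ => ?_
    rw [Sym2.eq_iff]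
    simp only [Prod.mk.injEq, EmbeddingLike.apply_eq_iff_eq]
    constructor
    · rintro (⟨⟨h1, h2⟩, h3, h4⟩ | ⟨⟨h1, h2⟩, h3, h4⟩)
      · exact Or.inl ⟨h1.symm, h2.symm, h3.symm, h4.symm⟩
      · exact Or.inr ⟨h3.symm, h4.symm, h1.symm, h2.symm⟩
    · rintro (⟨h1, h2, h3, h4⟩ | ⟨h1, h2, h3, h4⟩)
      · exact Or.inl ⟨⟨h1.symm, h2.symm⟩, h3.symm, h4.symm⟩
      · exact Or.inr ⟨⟨h3.symm, h4.symm⟩, h1.symm, h2.symm⟩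
  have hex : ∃ z, s((φ U, a), (φ V, b)) ∈ (F z).edges := by
    obtain ⟨p, i, r, hr, ⟨h1, h2, h3⟩ | ⟨h1, h2, h3⟩⟩ := hcov (V - U) hUV a b
    · refine ⟨(p, U - f p i r), (hmem _).mpr ⟨i, r, hr, Or.inl ⟨by simp, h2, ?_, h3⟩⟩⟩
      dsimp only
      linear_combination h1
    · refine ⟨(p, V - f p i r), (hmem _).mpr ⟨i, r, hr, Or.inr ⟨by simp, h2, ?_, h3⟩⟩⟩
      dsimp only
      linear_combination -h1
  have hlab : ∀ z, s((φ U, a), (φ V, b)) ∈ (F z).edges → ∃ (q : Σ i : Fin t, Fin (m i)) (o : Bool),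
      L (z.1, q, o) = (⟨V - U, hUV⟩, a, b) ∧
      z.2 = (if o then U else V) - f z.1 q.1 q.2.val := by
    intro z hz
    obtain ⟨i, r, hr, ⟨h1, h2, h3, h4⟩ | ⟨h1, h2, h3, h4⟩⟩ := (hmem z).mp hz
    · refine ⟨⟨i, ⟨r, hr⟩⟩, true, ?_, ?_⟩
      · have : f z.1 i ((r + 1) % m i) - f z.1 i r = V - U := by linear_combination h3 - h1
        simp [L, this, h2, h4]
      · simp only [if_true]
        linear_combination h1
    · refine ⟨⟨i, ⟨r, hr⟩⟩, false, ?_, ?_⟩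
      · have : f z.1 i r - f z.1 i ((r + 1) % m i) = V - U := by linear_combination h1 - h3
        simp [L, this, h2, h4]
      · simp only [Bool.false_eq_true, if_false]
        linear_combination h1
  obtain ⟨z, hz⟩ := hex
  refine ⟨z, hz, ?_⟩
  intro y hy
  obtain ⟨q, o, h1, h2⟩ := hlab z hz
  obtain ⟨q', o', h1', h2'⟩ := hlab y hy
  have h3 := hLi (h1'.trans h1.symm)
  simp only [Prod.mk.injEq] at h3
  obtain ⟨h4, h5, h6⟩ := h3
  subst h5 h6
  refine Prod.ext h4 ?_
  rw [h2, h2', h4]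

/-! ### Assembly -/

lemma intCast_inj_of_lt {n : ℕ} {a b : ℤ} (ha : 0 ≤ a) (ha' : a < n) (hb : 0 ≤ b) (hb' : b < n)
    (h : (a : ZMod n) = (b : ZMod n)) : a = b := by
  rw [ZMod.intCast_eq_intCast_iff] at h
  unfold Int.ModEq at h
  rwa [Int.emod_eq_of_lt ha ha', Int.emod_eq_of_lt hb hb'] at h

lemma exists_shift {n m1 m2 WA WB : ℕ} (hWA : WA ≤ n) (hw : WA + WB ≤ n ∨ m1 * m2 < n)
    (f g : ℕ → ℤ) (hf : ∀ i, i < m1 → 0 ≤ f i ∧ f i < WA) (hg : ∀ i, i < m2 → 0 ≤ g i ∧ g i < WB) :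
    ∃ c : ZMod n, ∀ r r', r < m1 → r' < m2 → (f r : ZMod n) ≠ (g r' : ZMod n) + c := by
  rcases hw with hw | hw
  · refine ⟨((WA : ℤ) : ZMod n), ?_⟩
    intro r r' hr hr' h
    have h1 := hf r hr
    have h2 := hg r' hr'
    rw [← Int.cast_add] at h
    have := intCast_inj_of_lt (by omega) (by omega) (by omega) (by omega) h
    omega
  · have : NeZero n := ⟨by omega⟩
    classical
    let S : Finset (ZMod n) := Finset.univ.image
      (fun z : Fin m1 × Fin m2 => (f z.1 : ZMod n) - (g z.2 : ZMod n))
    have hS : S.card < Fintype.card (ZMod n) := by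
      refine lt_of_le_of_lt Finset.card_image_le ?_
      simpa [ZMod.card] using hw
    obtain ⟨c, hc⟩ : ∃ c, c ∉ S := by
      by_contra hne
      push Not at hne
      have : S = Finset.univ := Finset.eq_univ_iff_forall.mpr hne
      rw [this, Finset.card_univ] at hS
      exact lt_irrefl _ hS
    refine ⟨c, ?_⟩
    intro r r' hr hr' h
    apply hc
    refine Finset.mem_image.mpr ⟨(⟨r, hr⟩, ⟨r', hr'⟩), Finset.mem_univ _, ?_⟩
    dsimp only
    rw [h]; ring

lemma cov_repr {N h n : ℕ} (hh : h ≤ 1) (hn : n = 2 * N + 1) (d : ZMod n) (hd : d ≠ 0) :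
    ∃ δ, Cov N h δ ∧ ((δ : ZMod n) = d ∨ (δ : ZMod n) = -d) := by
  have : NeZero n := ⟨by omega⟩
  have h1 : d.val < n := ZMod.val_lt d
  have h0 : d.val ≠ 0 := by rwa [Ne, ZMod.val_eq_zero]
  have h2 : ((d.val : ℕ) : ZMod n) = d := ZMod.natCast_zmod_val d
  have h3 : ((n - d.val : ℕ) : ZMod n) = -d := by
    rw [Nat.cast_sub h1.le, h2]; simp
  by_cases hc : Cov N h d.val
  · exact ⟨_, hc, Or.inl h2⟩
  · refine ⟨_, ?_, Or.inr h3⟩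
    unfold Cov at *
    omega

theorem assemble {m1 m2 k n s h WA WB : ℕ} (hm1 : 2 ≤ m1) (hm2 : 2 ≤ m2) (hh : h ≤ 1)
    (hn : n = 2 * ((m1 + m2) * k) + 1) (hns : n = s + (m1 + m2))
    {SA SB : ℕ → ℕ → Prop}
    (hA : ∀ j, j < k → HasQuad m1 (SA j) WA) (hB : ∀ j, j < k → HasQuad m2 (SB j) WB)
    (hcov : ∀ d, Cov ((m1 + m2) * k) h d → ∃ j, j < k ∧ (SA j d ∨ SB j d))
    (hWA : WA ≤ n) (hWB : WB ≤ n) (hw : WA + WB ≤ n ∨ m1 * m2 < n) :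
    HOPSolution n s 2 ![m1, m2] := by
  choose f x f1 f2 f3 using fun j : Fin k => hA j j.2
  choose g y g1 g2 g3 using fun j : Fin k => hB j j.2
  have hc := fun z : Fin k × Fin 4 => exists_shift hWA hw (f z.1 z.2) (g z.1 z.2)
    (f1 z.1 z.2) (g1 z.1 z.2)
  choose c hc using hc
  refine reduction (k := k) (μ := m1 + m2) (m := ![m1, m2]) ?_ (by simp) hns hn
    (fun z i r => if i = 0 then ((f z.1 z.2 r : ℤ) : ZMod n) else ((g z.1 z.2 r : ℤ) : ZMod n) + c z)
    (fun z i r => if i = 0 then x z.1 z.2 r else y z.1 z.2 r) ?_ ?_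
  · intro i
    fin_cases i
    · exact hm1
    · exact hm2
  · intro z i i' r r' hr hr' he
    fin_cases i <;> fin_cases i'
    · refine ⟨rfl, ?_⟩
      simp at hr hr' he
      have b1 := f1 z.1 z.2 r hr
      have b2 := f1 z.1 z.2 r' hr'
      exact f2 z.1 z.2 r r' hr hr'
        (intCast_inj_of_lt b1.1 (by omega) b2.1 (by omega) he)
    · exfalso
      simp at hr hr' he
      exact hc z r r' hr hr' he
    · exfalso
      simp at hr hr' he
      exact hc z r' r hr' hr he.symm
    · refine ⟨rfl, ?_⟩
      simp at hr hr' he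
      have b1 := g1 z.1 z.2 r hr
      have b2 := g1 z.1 z.2 r' hr'
      exact g2 z.1 z.2 r r' hr hr'
        (intCast_inj_of_lt b1.1 (by omega) b2.1 (by omega) he)
  · have main : ∀ δ, Cov ((m1 + m2) * k) h δ → ∀ a b : Fin 2, ∃ z : Fin k × Fin 4,
        (∃ r, r < m1 ∧
          ((f z.1 z.2 ((r + 1) % m1) - f z.1 z.2 r = δ ∧ x z.1 z.2 r = a ∧
              x z.1 z.2 ((r + 1) % m1) + 1 = b) ∨
           (f z.1 z.2 r - f z.1 z.2 ((r + 1) % m1) = δ ∧ x z.1 z.2 r = b ∧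
              x z.1 z.2 ((r + 1) % m1) + 1 = a))) ∨
        (∃ r, r < m2 ∧
          ((g z.1 z.2 ((r + 1) % m2) - g z.1 z.2 r = δ ∧ y z.1 z.2 r = a ∧
              y z.1 z.2 ((r + 1) % m2) + 1 = b) ∨
           (g z.1 z.2 r - g z.1 z.2 ((r + 1) % m2) = δ ∧ y z.1 z.2 r = b ∧
              y z.1 z.2 ((r + 1) % m2) + 1 = a))) := by
      intro δ hδ a b
      obtain ⟨j, hj, hS | hS⟩ := hcov δ hδ
      · obtain ⟨p, hp⟩ := f3 ⟨j, hj⟩ δ hS a b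
        exact ⟨(⟨j, hj⟩, p), Or.inl hp⟩
      · obtain ⟨p, hp⟩ := g3 ⟨j, hj⟩ δ hS a b
        exact ⟨(⟨j, hj⟩, p), Or.inr hp⟩
    have cast_eq : ∀ (u v : ℤ) (δ : ℕ), u - v = δ → (u : ZMod n) - (v : ZMod n) = (δ : ZMod n) := by
      intro u v δ h
      have := congrArg (fun w : ℤ => (w : ZMod n)) h
      simpa using this
    intro d hd a b
    obtain ⟨δ, hδ, hδd | hδd⟩ := cov_repr hh hn d hd
    · obtain ⟨z, ⟨r, hr, h⟩ | ⟨r, hr, h⟩⟩ := main δ hδ a b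
      · refine ⟨z, 0, r, hr, ?_⟩
        simp only [if_true, Matrix.cons_val_zero]
        rcases h with ⟨h, h'⟩ | ⟨h, h'⟩
        · exact Or.inl ⟨by rw [← hδd]; exact cast_eq _ _ _ h, h'⟩
        · exact Or.inr ⟨by rw [← hδd]; exact cast_eq _ _ _ h, h'⟩
      · refine ⟨z, 1, r, hr, ?_⟩
        simp only [one_ne_zero, if_false, Matrix.cons_val_one, Matrix.cons_val_zero]
        rcases h with ⟨h, h'⟩ | ⟨h, h'⟩
        · exact Or.inl ⟨by rw [← hδd]; have := cast_eq _ _ _ h; linear_combination this, h'⟩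
        · exact Or.inr ⟨by rw [← hδd]; have := cast_eq _ _ _ h; linear_combination this, h'⟩
    · obtain ⟨z, ⟨r, hr, h⟩ | ⟨r, hr, h⟩⟩ := main δ hδ b a
      · refine ⟨z, 0, r, hr, ?_⟩
        simp only [if_true, Matrix.cons_val_zero]
        rcases h with ⟨h, h'⟩ | ⟨h, h'⟩
        · exact Or.inr ⟨by have := cast_eq _ _ _ h; linear_combination -this - hδd, h'⟩
        · exact Or.inl ⟨by have := cast_eq _ _ _ h; linear_combination -this - hδd, h'⟩
      · refine ⟨z, 1, r, hr, ?_⟩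
        simp only [one_ne_zero, if_false, Matrix.cons_val_one, Matrix.cons_val_zero]
        rcases h with ⟨h, h'⟩ | ⟨h, h'⟩
        · exact Or.inr ⟨by have := cast_eq _ _ _ h; linear_combination -this - hδd, h'⟩
        · exact Or.inl ⟨by have := cast_eq _ _ _ h; linear_combination -this - hδd, h'⟩

/-! ### Case analysis -/

def Ready (a b k : ℕ) : Prop :=
  ∃ (h WA WB : ℕ) (SA SB : ℕ → ℕ → Prop), h ≤ 1 ∧
    (∀ j, j < k → HasQuad a (SA j) WA) ∧ (∀ j, j < k → HasQuad b (SB j) WB) ∧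
    (∀ d, Cov ((a + b) * k) h d → ∃ j, j < k ∧ (SA j d ∨ SB j d)) ∧
    WA ≤ 2 * ((a + b) * k) + 1 ∧ WB ≤ 2 * ((a + b) * k) + 1 ∧
    (WA + WB ≤ 2 * ((a + b) * k) + 1 ∨ a * b < 2 * ((a + b) * k) + 1)

lemma Ready.symm {a b k : ℕ} (h : Ready a b k) : Ready b a k := by
  obtain ⟨h, WA, WB, SA, SB, h1, h2, h3, h4, h5, h6, h7⟩ := h
  refine ⟨h, WB, WA, SB, SA, h1, h3, h2, ?_, ?_, ?_, ?_⟩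
  · intro d hd
    rw [add_comm] at hd
    obtain ⟨j, hj, h⟩ := h4 d hd
    exact ⟨j, hj, h.symm⟩
  · rw [add_comm b a]; exact h6
  · rw [add_comm b a]; exact h5
  · rw [add_comm b a, mul_comm b a, add_comm WB WA]; exact h7

lemma ready_even_even {q r k : ℕ} (hq : 1 ≤ q) (hr : q ≤ r) (hk : 1 ≤ k) :
    Ready (2 * q) (2 * r) k := by
  obtain ⟨SA, h1, hh1, a1, a2, -, -⟩ := chain_even q 0 0 k hq (by omega) (by omega)
  have X1 : q ≤ q * k := Nat.le_mul_of_pos_right _ (by omega)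
  have Y1 : r ≤ r * k := Nat.le_mul_of_pos_right _ (by omega)
  have e1 : 2 * q * k = 2 * (q * k) := by ring
  have e2 : 2 * r * k = 2 * (r * k) := by ring
  have e3 : (2 * q + 2 * r) * k = 2 * (q * k) + 2 * (r * k) := by ring
  obtain ⟨SB, h2, hh2, b1, b2, -, -⟩ := chain_even r (0 + 2 * q * k) h1 k (by omega) hh1 (by omega)
  refine ⟨h2, _, _, SA, SB, hh2, a1, b1, ?_, ?_, ?_, ?_⟩
  · intro d hd
    rw [e3] at hd
    rw [e1, e2, zero_add] at b2
    rcases b2 d hd with h | ⟨j, hj, h⟩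
    · rw [e1, zero_add] at a2
      rcases a2 d h with h | ⟨j, hj, h⟩
      · unfold Cov at h; omega
      · exact ⟨j, hj, Or.inl h⟩
    · exact ⟨j, hj, Or.inr h⟩
  · omega
  · omega
  · by_cases hq1 : q = 1
    · right
      rw [e3]
      subst hq1
      have : 2 * 1 * (2 * r) = 4 * r := by ring
      omega
    · left
      omega

lemma ready_odd_even {q r k : ℕ} (hr : 1 ≤ r) (hk : 1 ≤ k) :
    Ready (2 * q + 3) (2 * r) k := by
  obtain ⟨h0, e, hh0, s1, s2, s3⟩ := skolem_triples k hk
  have Y1 : r ≤ r * k := Nat.le_mul_of_pos_right _ (by omega)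
  have X1 : q ≤ q * k := Nat.le_mul_of_pos_right _ (by omega)
  have e1 : 2 * q * k = 2 * (q * k) := by ring
  have e2 : 2 * r * k = 2 * (r * k) := by ring
  have e3 : (2 * q + 3 + 2 * r) * k = 3 * k + 2 * (q * k) + 2 * (r * k) := by ring
  obtain ⟨SA, h1, hh1, a1, a2, -, -⟩ := chain_odd q (3 * k) h0 k k (fun j => j + 1)
    (fun j => e (j + 1)) hh0 (by omega)
    (by
      intro j hj
      have := s2 (j + 1) (by omega) (by omega)
      omega)
    (by
      have := s2 1 (by omega) (by omega)
      left
      by_cases hk1 : k = 1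
      · subst hk1
        have := s1 (by norm_num)
        simp only [zero_add]
        omega
      · simp only [zero_add]
        omega)
  obtain ⟨SB, h2, hh2, b1, b2, -, -⟩ := chain_even r (3 * k + 2 * q * k) h1 k hr hh1 (by omega)
  refine ⟨h2, _, _, _, SB, hh2, a1, b1, ?_, ?_, ?_, ?_⟩
  · intro d hd
    rw [e3] at hd
    rw [e1, e2] at b2
    rcases b2 d hd with h | ⟨j, hj, h⟩
    · rw [e1] at a2
      rcases a2 d h with h | ⟨j, hj, h⟩
      · obtain ⟨t, t1, t2, t3⟩ := s3 d h
        refine ⟨t - 1, by omega, Or.inl (Or.inl ?_)⟩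
        rw [show t - 1 + 1 = t by omega]
        exact t3
      · exact ⟨j, hj, Or.inl (Or.inr h)⟩
    · exact ⟨j, hj, Or.inr h⟩
  · omega
  · omega
  · by_cases hr1 : r = 1
    · right
      rw [e3]
      subst hr1
      have : (2 * q + 3) * (2 * 1) = 4 * q + 6 := by ring
      omega
    · left
      have : 2 * k ≤ r * k := Nat.mul_le_mul_right k (by omega)
      omega

lemma ready_three_odd {q k : ℕ} (hk : 1 ≤ k) : Ready 3 (2 * q + 3) k := by
  obtain ⟨h0, e, hh0, s1, s2, s3⟩ := skolem_triples (2 * k) (by omega)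
  have X1 : q ≤ q * k := Nat.le_mul_of_pos_right _ (by omega)
  have e1 : 2 * q * k = 2 * (q * k) := by ring
  have e3 : (3 + (2 * q + 3)) * k = 3 * (2 * k) + 2 * (q * k) := by ring
  obtain ⟨SB, h2, hh2, b1, b2, -, -⟩ := chain_odd q (3 * (2 * k)) h0 k k (fun j => j + 1)
    (fun j => e (j + 1)) hh0 (by omega)
    (by
      intro j hj
      have := s2 (j + 1) (by omega) (by omega)
      omega)
    (by
      have := s2 1 (by omega) (by omega)
      left
      simp only [zero_add]
      omega)
  have a1 : ∀ j, j < k → HasQuad 3 (fun d => d = k + j + 1 ∨ d = e (k + j + 1) ∨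
      d = e (k + j + 1) + (k + j + 1)) (3 * (2 * k) + h0 + 1) := by
    intro j hj
    have := s2 (k + j + 1) (by omega) (by omega)
    exact (quad_three (k + j + 1) (e (k + j + 1)) (by omega) (by omega)).mono (by omega)
  refine ⟨h2, _, _, _, _, hh2, a1, b1, ?_, ?_, ?_, ?_⟩
  · intro d hd
    rw [e3] at hd
    rw [e1] at b2
    rcases b2 d hd with h | ⟨j, hj, h⟩
    · obtain ⟨t, t1, t2, t3⟩ := s3 d h
      by_cases htk : t ≤ k
      · refine ⟨t - 1, by omega, Or.inr (Or.inl ?_)⟩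
        rw [show t - 1 + 1 = t by omega]
        exact t3
      · refine ⟨t - k - 1, by omega, Or.inl ?_⟩
        rw [show k + (t - k - 1) + 1 = t by omega]
        exact t3
    · exact ⟨j, hj, Or.inr (Or.inr h)⟩
  · omega
  · omega
  · by_cases hq : q ≤ 1
    · right
      rw [e3]
      omega
    · left
      have : 2 * k ≤ q * k := Nat.mul_le_mul_right k (by omega)
      omega

lemma ready_odd_odd {q r k : ℕ} (hq : 1 ≤ q) (hr : q ≤ r) (hk : 1 ≤ k)
    (h55 : ¬ (q = 1 ∧ r = 1 ∧ k = 1)) (h77 : ¬ (q = 2 ∧ r = 2 ∧ k = 1)) :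
    Ready (2 * q + 3) (2 * r + 3) k := by
  obtain ⟨h0, e, hh0, s1, s2, s3⟩ := skolem_triples (2 * k) (by omega)
  have X1 : 1 * k ≤ q * k := Nat.mul_le_mul_right k hq
  have X2 : q * k ≤ r * k := Nat.mul_le_mul_right k hr
  have e1 : 2 * q * k = 2 * (q * k) := by ring
  have e2 : 2 * r * k = 2 * (r * k) := by ring
  have e3 : (2 * q + 3 + (2 * r + 3)) * k = 3 * (2 * k) + 2 * (q * k) + 2 * (r * k) := by ring
  obtain ⟨SA, h1, hh1, a1, a2, a3, a4⟩ := chain_odd q (3 * (2 * k)) h0 k k (fun j => j + 1)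
    (fun j => e (j + 1)) hh0 (by omega)
    (by
      intro j hj
      have := s2 (j + 1) (by omega) (by omega)
      omega)
    (by
      have := s2 1 (by omega) (by omega)
      left
      simp only [zero_add]
      omega)
  obtain ⟨SB, h2, hh2, b1, b2, b3, b4⟩ := chain_odd r (3 * (2 * k) + 2 * q * k) h1 k (2 * k)
    (fun j => k + j + 1) (fun j => e (k + j + 1)) hh1 (by omega)
    (by
      intro j hj
      have := s2 (k + j + 1) (by omega) (by omega)
      omega)
    (by
      have := s2 (k + 0 + 1) (by omega) (by omega)
      left
      omega)
  refine ⟨h2, _, _, _, _, hh2, a1, b1, ?_, ?_, ?_, ?_⟩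
  · intro d hd
    rw [e3] at hd
    rw [e1, e2] at b2
    rcases b2 d hd with h | ⟨j, hj, h⟩
    · rw [e1] at a2
      rcases a2 d h with h | ⟨j, hj, h⟩
      · obtain ⟨t, t1, t2, t3⟩ := s3 d h
        by_cases htk : t ≤ k
        · refine ⟨t - 1, by omega, Or.inl (Or.inl ?_)⟩
          rw [show t - 1 + 1 = t by omega]
          exact t3
        · refine ⟨t - k - 1, by omega, Or.inr (Or.inl ?_)⟩
          rw [show k + (t - k - 1) + 1 = t by omega]
          exact t3
      · exact ⟨j, hj, Or.inl (Or.inr h)⟩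
    · exact ⟨j, hj, Or.inr (Or.inr h)⟩
  · omega
  · omega
  · by_cases hr1 : r = 1
    · right
      have hq1 : q = 1 := by omega
      subst hr1 hq1
      omega
    · left
      by_cases hr2 : r = 2
      · subst hr2
        have hb := b3 (by norm_num)
        by_cases hq1 : q = 1
        · have := a4 hq1 hk
          omega
        · have hq2 : q = 2 := by omega
          subst hq2
          have ha := a3 (by norm_num)
          by_cases hk2 : k = 2
          · have := s1 (by omega)
            omega
          · omega
      · have : 3 * k ≤ r * k := Nat.mul_le_mul_right k (by omega)
        omega

/-- The set of differences of an explicit cycle. -/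
def listS (l : ℕ) (L : List ℤ) (d : ℕ) : Prop :=
  ∃ i : Fin l, L.getD ((i.val + 1) % l) 0 - L.getD i.val 0 = d ∨
    L.getD i.val 0 - L.getD ((i.val + 1) % l) 0 = d

instance (l : ℕ) (L : List ℤ) (d : ℕ) : Decidable (listS l L d) := by
  unfold listS; infer_instance

lemma quad_list (l : ℕ) (L : List ℤ) (W : ℕ) (hl : 2 ≤ l)
    (h1 : ∀ i : Fin l, 0 ≤ L.getD i.val 0 ∧ L.getD i.val 0 < W)
    (h2 : ∀ i j : Fin l, L.getD i.val 0 = L.getD j.val 0 → i = j) :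
    HasQuad l (listS l L) W := by
  apply HasCycle.quad hl
  refine ⟨fun i => L.getD i 0, fun i hi => h1 ⟨i, hi⟩, fun i j hi hj h => ?_, ?_⟩
  · exact congrArg Fin.val (h2 ⟨i, hi⟩ ⟨j, hj⟩ h)
  · rintro d ⟨i, hi⟩
    exact ⟨i.val, i.2, hi⟩

lemma ready_five_five : Ready 5 5 1 := by
  refine ⟨1, 12, 9, fun _ => listS 5 [0, 11, 10, 6, 9], fun _ => listS 5 [0, 2, 7, 1, 8],
    le_refl _, fun _ _ => quad_list _ _ _ (by norm_num) (by decide) (by decide),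
    fun _ _ => quad_list _ _ _ (by norm_num) (by decide) (by decide), ?_, by norm_num,
    by norm_num, Or.inl (by norm_num)⟩
  intro d hd
  have key : ∀ d : Fin 12, 1 ≤ d.val → d.val ≠ 10 →
      (listS 5 [0, 11, 10, 6, 9] d.val ∨ listS 5 [0, 2, 7, 1, 8] d.val) := by decide
  unfold Cov at hd
  exact ⟨0, by norm_num, key ⟨d, by omega⟩ hd.1 (by dsimp only; omega)⟩

lemma ready_seven_seven : Ready 7 7 1 := by
  refine ⟨1, 16, 13, fun _ => listS 7 [0, 15, 14, 12, 9, 4, 13],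
    fun _ => listS 7 [0, 4, 10, 3, 11, 1, 12],
    le_refl _, fun _ _ => quad_list _ _ _ (by norm_num) (by decide) (by decide),
    fun _ _ => quad_list _ _ _ (by norm_num) (by decide) (by decide), ?_, by norm_num,
    by norm_num, Or.inl (by norm_num)⟩
  intro d hd
  have key : ∀ d : Fin 16, 1 ≤ d.val → d.val ≠ 14 →
      (listS 7 [0, 15, 14, 12, 9, 4, 13] d.val ∨ listS 7 [0, 4, 10, 3, 11, 1, 12] d.val) := by
    decide
  unfold Cov at hd
  exact ⟨0, by norm_num, key ⟨d, by omega⟩ hd.1 (by dsimp only; omega)⟩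

lemma ready_all {a b k : ℕ} (ha : 2 ≤ a) (hab : a ≤ b) (hk : 1 ≤ k) : Ready a b k := by
  rcases Nat.mod_two_eq_zero_or_one a with h1 | h1 <;>
    rcases Nat.mod_two_eq_zero_or_one b with h2 | h2
  · have := ready_even_even (q := a / 2) (r := b / 2) (by omega) (by omega) hk
    rwa [show 2 * (a / 2) = a by omega, show 2 * (b / 2) = b by omega] at this
  · have := (ready_odd_even (q := (b - 3) / 2) (r := a / 2) (by omega) hk).symm
    rwa [show 2 * ((b - 3) / 2) + 3 = b by omega, show 2 * (a / 2) = a by omega] at this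
  · have := ready_odd_even (q := (a - 3) / 2) (r := b / 2) (by omega) hk
    rwa [show 2 * ((a - 3) / 2) + 3 = a by omega, show 2 * (b / 2) = b by omega] at this
  · by_cases h3 : a = 3
    · subst h3
      have := ready_three_odd (q := (b - 3) / 2) hk
      rwa [show 2 * ((b - 3) / 2) + 3 = b by omega] at this
    · by_cases h55 : a = 5 ∧ b = 5 ∧ k = 1
      · obtain ⟨rfl, rfl, rfl⟩ := h55
        exact ready_five_five
      by_cases h77 : a = 7 ∧ b = 7 ∧ k = 1
      · obtain ⟨rfl, rfl, rfl⟩ := h77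
        exact ready_seven_seven
      have := ready_odd_odd (q := (a - 3) / 2) (r := (b - 3) / 2) (by omega) (by omega) hk
        (by omega) (by omega)
      rwa [show 2 * ((a - 3) / 2) + 3 = a by omega, show 2 * ((b - 3) / 2) + 3 = b by omega]
        at this

/-- Theorem 1.1(i): if `s ≥ 0`, `2 ≤ m₁ ≤ m₂`, `m = m₁ + m₂`, `n = s + m` and
`n ≡ 1 (mod 2m)`, then `HOP(2^⟨s⟩, 2m₁, 2m₂)` has a solution. -/
theorem hop_two_round_tables_mod_one (s m₁ m₂ m n : ℕ)
    (hm₁ : 2 ≤ m₁) (hm₁₂ : m₁ ≤ m₂) (hm : m = m₁ + m₂) (hn : n = s + m)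
    (hcong : n ≡ 1 [MOD 2 * m]) :
    HOPSolution n s 2 ![m₁, m₂] := by
  obtain ⟨k, hk, hnk⟩ : ∃ k, 1 ≤ k ∧ n = 2 * ((m₁ + m₂) * k) + 1 := by
    have hdvd : 2 * m ∣ n - 1 := (Nat.modEq_iff_dvd' (by omega)).mp hcong.symm
    obtain ⟨k, hk⟩ := hdvd
    refine ⟨k, ?_, ?_⟩
    · rcases Nat.eq_zero_or_pos k with h | h
      · subst h; omega
      · exact h
    · rw [← hm, ← mul_assoc]; omega
  obtain ⟨h, WA, WB, SA, SB, h1, h2, h3, h4, h5, h6, h7⟩ := ready_all (k := k) hm₁ hm₁₂ hk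
  rw [← hnk] at h5 h6 h7
  exact assemble hm₁ (by omega) h1 hnk (hm ▸ hn) h2 h3 h4 h5 h6 h7
end

section
/- Let k ≥ 1 be an integer, let n = 20k + 5 and s = n − 10. Then HOP(2^⟨s⟩, 4, 6, 10) has a solution, i.e., HOP(2^⟨s⟩, 2m_1, 2m_2, 2m_3) has a solution with (m_1, m_2, m_3) = (2, 3, 5). (In the paper this is stated as: 4K_n^• admits an HOP (C_2, C_3, C_5)-decomposition, which by the paper's Theorem 3.2 is equivalent to the stated HOP solution.) -/
namespace HOPaux

/-- successor along the three cycles (0 1)(2 3 4)(5 6 7 8 9) -/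
def sig : Fin 10 → Fin 10 := ![1, 0, 3, 4, 2, 6, 7, 8, 9, 5]

abbrev Idx (i : Fin 3) : Type := ZMod (2 * (![2, 3, 5] : Fin 3 → ℕ) i)

def pos (i : Fin 3) (j : Idx i) : Fin 10 × Fin 2 :=
  (Fin.ofNat 10 ((![0, 2, 5] : Fin 3 → ℕ) i + j.val / 2), Fin.ofNat 2 j.val)

lemma pos_even : ∀ (i : Fin 3) (j : Idx i), j.val % 2 = 0 →
    (pos i j).2 = 0 ∧ pos i (j + 1) = ((pos i j).1, 1)
  | 0 => show ∀ j : ZMod 4, _ by decide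
  | 1 => show ∀ j : ZMod 6, _ by decide
  | 2 => show ∀ j : ZMod 10, _ by decide

lemma pos_odd : ∀ (i : Fin 3) (j : Idx i), j.val % 2 = 1 →
    (pos i j).2 = 1 ∧ pos i (j + 1) = (sig (pos i j).1, 0)
  | 0 => show ∀ j : ZMod 4, _ by decide
  | 1 => show ∀ j : ZMod 6, _ by decide
  | 2 => show ∀ j : ZMod 10, _ by decide

/-- the inverse of `pos` -/
def sop : Fin 10 × Fin 2 → (i : Fin 3) × Idx i := fun p =>
  if p.1.val < 2 then ⟨0, ((2 * p.1.val + p.2.val : ℕ) : ZMod 4)⟩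
  else if p.1.val < 5 then ⟨1, ((2 * (p.1.val - 2) + p.2.val : ℕ) : ZMod 6)⟩
  else ⟨2, ((2 * (p.1.val - 5) + p.2.val : ℕ) : ZMod 10)⟩

lemma pos_sop : ∀ p : Fin 10 × Fin 2, pos (sop p).1 (sop p).2 = p := by decide

lemma sop_pos : ∀ (i : Fin 3) (j : Idx i), sop (pos i j) = ⟨i, j⟩
  | 0 => show ∀ j : ZMod 4, _ by intro j; fin_cases j <;> rfl
  | 1 => show ∀ j : ZMod 6, _ by intro j; fin_cases j <;> rfl
  | 2 => show ∀ j : ZMod 10, _ by intro j; fin_cases j <;> rfl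

def posEquiv : ((i : Fin 3) × Idx i) ≃ Fin 10 × Fin 2 where
  toFun x := pos x.1 x.2
  invFun := sop
  left_inv x := sop_pos x.1 x.2
  right_inv := pos_sop

lemma sig_ne : ∀ j, sig j ≠ j := by decide

lemma isIEdge_iff {n : ℕ} (u w : HOPVertex n) :
    IsIEdge s(u, w) ↔ u.1 = w.1 ∧ u.2 ≠ w.2 := by
  obtain ⟨x, a⟩ := u
  obtain ⟨y, b⟩ := w
  simp only [IsIEdge, HOPspouse, Sym2.eq_iff]
  constructor
  · rintro ⟨⟨z, c⟩, h⟩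
    simp only [Prod.mk.injEq] at h
    rcases h with ⟨⟨rfl, rfl⟩, rfl, rfl⟩ | ⟨⟨rfl, rfl⟩, rfl, rfl⟩
    · refine ⟨rfl, ?_⟩; revert a; decide
    · refine ⟨rfl, ?_⟩; revert b; decide
  · rintro ⟨h1, h2⟩
    replace h1 : x = y := h1
    replace h2 : a ≠ b := h2
    subst h1
    refine ⟨(x, a), Or.inl ⟨rfl, ?_⟩⟩
    simp only [Prod.mk.injEq, true_and]
    revert a b; decide

/-- Building a factor from ten distinct couples with orientations. -/
lemma exists_factor {n s : ℕ} (hs : n = s + 10) (v : Fin 10 → Fin n)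
    (hv : Function.Injective v) (b : Fin 10 → Fin 2) :
    ∃ F : HOPFactor n s 3 ![2, 3, 5], ∀ e, ¬ IsIEdge e →
      (e ∈ F.edges ↔ ∃ j, e = s((v j, b j + 1), (v (sig j), b (sig j)))) := by
  classical
  have hcard : Fintype.card {x : Fin n // x ∉ Set.range v} = s := by
    rw [Fintype.card_of_subtype (Finset.univ.image v)ᶜ (by intro x; simp), Finset.card_compl,
      Finset.card_image_of_injective _ hv]
    simp [hs]
  let E : Fin s ≃ {x : Fin n // x ∉ Set.range v} :=
    (Fintype.equivFinOfCardEq hcard).symm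
  have hc : ∀ (i : Fin 3) (j : Idx i), j.val % 2 = 0 ∨ j.val % 2 = 1 := by
    intro i j; omega
  refine ⟨{ pair := fun a => ((E a).1, 0)
            cyc := fun i j => (v (pos i j).1, b (pos i j).1 + (pos i j).2)
            alt_even := ?_
            alt_odd := ?_
            spanning := ?_ }, ?_⟩
  · intro i j hj
    obtain ⟨h1, h2⟩ := pos_even i j hj
    simp only [h1, h2, HOPspouse, add_zero]
  · intro i j hj
    obtain ⟨h1, h2⟩ := pos_odd i j hj
    rw [isIEdge_iff]
    simp only [h2]
    rintro ⟨h, -⟩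
    exact sig_ne _ (hv h).symm
  · have hsurj : Function.Surjective (Sum.elim
        (fun a : Fin s × Fin 2 => if a.2 = 0 then (((E a.1).1, 0) : HOPVertex n)
          else HOPspouse ((E a.1).1, 0))
        (fun x : (i : Fin 3) × Idx i =>
          ((v (pos x.1 x.2).1, b (pos x.1 x.2).1 + (pos x.1 x.2).2) : HOPVertex n))) := by
      rintro ⟨x, c⟩
      by_cases hx : x ∈ Set.range v
      · obtain ⟨j, rfl⟩ := hx
        refine ⟨Sum.inr (sop (j, c - b j)), ?_⟩
        simp [pos_sop]
      · refine ⟨Sum.inl (E.symm ⟨x, hx⟩, c), ?_⟩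
        have : c = 0 ∨ c = 1 := by revert c; decide
        rcases this with rfl | rfl <;> simp [HOPspouse]
    haveI : Finite ((i : Fin 3) × Idx i) := Finite.of_equiv _ posEquiv.symm
    refine hsurj.bijective_of_nat_card_le ?_
    rw [Nat.card_sum, Nat.card_congr posEquiv]
    simp
    omega
  · intro e he
    constructor
    · rintro (⟨a, rfl⟩ | ⟨i, j, rfl⟩)
      · exact absurd ⟨_, rfl⟩ he
      · rcases hc i j with hj | hj
        · exfalso
          obtain ⟨h1, h2⟩ := pos_even i j hj
          apply he
          rw [isIEdge_iff]
          simp only [h1, h2]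
          refine ⟨trivial, ?_⟩
          generalize b (pos i j).1 = c
          revert c; decide
        · obtain ⟨h1, h2⟩ := pos_odd i j hj
          refine ⟨(pos i j).1, ?_⟩
          simp only [h1, h2, add_zero]
    · rintro ⟨j, rfl⟩
      refine Or.inr ⟨(sop (j, 1)).1, (sop (j, 1)).2, ?_⟩
      have hp := pos_sop (j, 1)
      rcases hc _ (sop (j, 1)).2 with hj | hj
      · obtain ⟨h1, h2⟩ := pos_even _ _ hj
        rw [hp] at h1
        exact absurd h1 (by simp)
      · obtain ⟨h1, h2⟩ := pos_odd _ _ hj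
        rw [hp] at h2
        simp only [hp, h2, add_zero]

/-- Counting lemma: a covering family of the right size is a solution. -/
lemma solution_of_cover {n s : ℕ} (hs : n = s + 10) {T : Type} [Fintype T]
    (hT : Fintype.card T * 10 = 2 * n * (n - 1))
    (v : T → Fin 10 → Fin n) (hv : ∀ t, Function.Injective (v t))
    (b : T → Fin 10 → Fin 2)
    (hcov : ∀ x y : Fin n, x ≠ y → ∀ p q : Fin 2, ∃ t j,
      (v t j = x ∧ b t j + 1 = p ∧ v t (sig j) = y ∧ b t (sig j) = q) ∨
      (v t j = y ∧ b t j + 1 = q ∧ v t (sig j) = x ∧ b t (sig j) = p)) :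
    HOPSolution n s 3 ![2, 3, 5] := by
  classical
  choose F hF using fun t => exists_factor hs (v t) (hv t) (b t)
  have hsum : ∑ i, (![2, 3, 5] : Fin 3 → ℕ) i = 10 := by decide
  refine ⟨Fintype.card T, by rw [hsum]; exact hT, ?_⟩
  let e := (Fintype.equivFin T).symm
  refine ⟨fun k => F (e k), ?_⟩
  -- the map to ordered pairs
  let A : Type := {z : Fin n × Fin n // z.1 ≠ z.2} × (Fin 2 × Fin 2)
  let g : (T × Fin 10) × Bool → A := fun z =>
    if z.2 then
      (⟨(v z.1.1 z.1.2, v z.1.1 (sig z.1.2)), fun h => sig_ne _ (hv _ h).symm⟩,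
        (b z.1.1 z.1.2 + 1, b z.1.1 (sig z.1.2)))
    else
      (⟨(v z.1.1 (sig z.1.2), v z.1.1 z.1.2), fun h => sig_ne _ (hv _ h)⟩,
        (b z.1.1 (sig z.1.2), b z.1.1 z.1.2 + 1))
  have hg : Function.Surjective g := by
    rintro ⟨⟨⟨x, y⟩, hxy⟩, p, q⟩
    obtain ⟨t, j, ⟨rfl, rfl, rfl, rfl⟩ | ⟨rfl, rfl, rfl, rfl⟩⟩ := hcov x y hxy p q
    · exact ⟨((t, j), true), rfl⟩
    · exact ⟨((t, j), false), rfl⟩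
  have hA : Nat.card A = 4 * (n * n - n) := by
    have h1 : Nat.card {z : Fin n × Fin n // z.1 ≠ z.2} = n * n - n := by
      have := Finset.offDiag_card (Finset.univ : Finset (Fin n))
      rw [Nat.card_eq_fintype_card, Fintype.card_subtype]
      rw [Finset.card_univ, Fintype.card_fin] at this
      rw [← this]
      congr 1
      ext z
      simp
    simp only [A, Nat.card_prod, h1]
    simp
    omega
  have hbij : Function.Bijective g := by
    refine hg.bijective_of_nat_card_le ?_
    rw [hA]
    rw [Nat.card_eq_fintype_card, Fintype.card_prod, Fintype.card_prod, Fintype.card_fin,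
      Fintype.card_bool, hT, ← Nat.mul_sub_one]
    apply le_of_eq
    ring
  have key : ∀ u w : HOPVertex n, u.1 ≠ w.1 → ∃! t, s(u, w) ∈ (F t).edges := by
    rintro ⟨x, p⟩ ⟨y, q⟩ hxy
    have hne : ¬ IsIEdge s((x, p), (y, q)) := by
      rw [isIEdge_iff]; exact fun h => hxy h.1
    have hkey : ∀ t, s((x, p), (y, q)) ∈ (F t).edges →
        ∃ j c, g ((t, j), c) = (⟨(x, y), hxy⟩, (p, q)) := by
      intro t ht
      obtain ⟨j, hj⟩ := (hF t _ hne).1 ht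
      rw [Sym2.eq_iff] at hj
      simp only [Prod.mk.injEq] at hj
      rcases hj with ⟨⟨rfl, rfl⟩, rfl, rfl⟩ | ⟨⟨rfl, rfl⟩, rfl, rfl⟩
      · exact ⟨j, true, rfl⟩
      · exact ⟨j, false, rfl⟩
    obtain ⟨t, j, h⟩ := hcov x y hxy p q
    refine ⟨t, (hF t _ hne).2 ⟨j, ?_⟩, ?_⟩
    · rcases h with ⟨rfl, rfl, rfl, rfl⟩ | ⟨rfl, rfl, rfl, rfl⟩
      · rfl
      · exact Sym2.eq_swap
    · intro t' ht'
      obtain ⟨j', c', h'⟩ := hkey t' ht'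
      have : ∃ c, g ((t, j), c) = (⟨(x, y), hxy⟩, (p, q)) := by
        rcases h with ⟨rfl, rfl, rfl, rfl⟩ | ⟨rfl, rfl, rfl, rfl⟩
        · exact ⟨true, rfl⟩
        · exact ⟨false, rfl⟩
      obtain ⟨c, hc⟩ := this
      have := hbij.1 (h'.trans hc.symm)
      simp only [Prod.mk.injEq] at this
      exact this.1.1
  intro ed hd hI
  induction ed using Sym2.ind with
  | _ u w =>
    have huw : u.1 ≠ w.1 := by
      intro h
      rw [isIEdge_iff] at hI
      apply hd
      rw [Sym2.mk_isDiag_iff]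
      exact Prod.ext h (by by_contra h2; exact hI ⟨h, h2⟩)
    obtain ⟨t, ht, hu⟩ := key u w huw
    refine ⟨e.symm t, by simpa using ht, ?_⟩
    intro k hk
    rw [← hu _ hk]
    simp

/-! ### The partition of the differences -/

set_option maxHeartbeats 4000000 in
lemma exists_diffs (k : ℕ) (hk : 1 ≤ k) : ∃ f : Fin k → Fin 10 → ℕ,
    (∀ i c, 3 ≤ f i c ∧ f i c ≤ 10 * k + 2) ∧
    (∀ i i' c c', f i c = f i' c' → i = i' ∧ c = c') ∧
    (∀ i, f i 2 + f i 3 = f i 4) ∧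
    (∀ i, f i 5 + f i 6 + f i 7 = f i 8 + f i 9) := by
  rcases Nat.lt_or_ge 1 k with h2 | h2
  · refine ⟨fun i => ![if i.1 = 0 then 3 * k + 3 else if i.1 = 1 then 5 * k + 5
        else 8 * k + 3 + 2 * i.1,
      if i.1 = 0 then 3 * k + 4 else if i.1 = 1 then 5 * k + 6
        else 8 * k + 4 + 2 * i.1,
      2 * i.1 + 3, 3 * k + 2 - i.1, 3 * k + 5 + i.1,
      2 * i.1 + 4, 5 * k + 4 - i.1, 6 * k + 7 + 2 * i.1, 5 * k + 7 + i.1,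
      6 * k + 8 + 2 * i.1], ?_, ?_, ?_, ?_⟩
    · rintro ⟨i, hi⟩ c
      fin_cases c <;> simp <;> (try split_ifs) <;> omega
    · rintro ⟨i, hi⟩ ⟨i', hi'⟩ c c' h
      rw [Fin.mk.injEq]
      fin_cases c <;> fin_cases c' <;> simp at h ⊢ <;> (try split_ifs at h) <;> omega
    · rintro ⟨i, hi⟩
      simp; omega
    · rintro ⟨i, hi⟩
      simp; omega
  · obtain rfl : k = 1 := by omega
    refine ⟨fun _ => ![10, 11, 3, 5, 8, 4, 6, 9, 7, 12], ?_, ?_, ?_, ?_⟩ <;> decide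

lemma exists_diffs_surj (k : ℕ) (hk : 1 ≤ k) : ∃ f : Fin k → Fin 10 → ℕ,
    (∀ i c, 3 ≤ f i c ∧ f i c ≤ 10 * k + 2) ∧
    (∀ i, Function.Injective (f i)) ∧
    (∀ d, 3 ≤ d → d ≤ 10 * k + 2 → ∃ i c, f i c = d) ∧
    (∀ i, f i 2 + f i 3 = f i 4) ∧
    (∀ i, f i 5 + f i 6 + f i 7 = f i 8 + f i 9) := by
  obtain ⟨f, h1, h2, h3, h4⟩ := exists_diffs k hk
  refine ⟨f, h1, fun i c c' h => (h2 i i c c' h).2, ?_, h3, h4⟩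
  let G : Fin k × Fin 10 → Finset.Icc 3 (10 * k + 2) := fun z =>
    ⟨f z.1 z.2, Finset.mem_Icc.2 (h1 _ _)⟩
  have hG : Function.Injective G := by
    rintro ⟨i, c⟩ ⟨i', c'⟩ h
    have := h2 i i' c c' (congrArg Subtype.val h)
    exact Prod.ext this.1 this.2
  have hb : Function.Bijective G := by
    rw [Fintype.bijective_iff_injective_and_card]
    refine ⟨hG, ?_⟩
    simp
    omega
  intro d hd hd'
  obtain ⟨⟨i, c⟩, h⟩ := hb.2 ⟨d, Finset.mem_Icc.2 ⟨hd, hd'⟩⟩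
  exact ⟨i, c, congrArg Subtype.val h⟩

/-! ### Base factors -/

lemma exists_shift {n a b : ℕ} [NeZero n] (h : a * b < n) (P : Fin a → ZMod n)
    (Q : Fin b → ZMod n) : ∃ t, ∀ i j, P i ≠ Q j + t := by
  by_contra! hcon
  have hs : Function.Surjective (fun z : Fin a × Fin b => P z.1 - Q z.2) := by
    intro t
    obtain ⟨i, j, hij⟩ := hcon t
    exact ⟨(i, j), by simp [hij]⟩
  have := Fintype.card_le_of_surjective _ hs
  simp [ZMod.card] at this
  omega

lemma exists_base {n : ℕ} [NeZero n] (hn : 25 ≤ n) (d : ℕ) (f : Fin 10 → ℕ)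
    (hd : 0 < d ∧ 2 * d < n)
    (hf : ∀ c, 0 < f c ∧ 2 * f c < n) (hi : Function.Injective f)
    (h3 : f 2 + f 3 = f 4) (h5 : f 5 + f 6 + f 7 = f 8 + f 9) :
    ∃ w : Fin 10 → ZMod n, Function.Injective w ∧
      w 1 = w 0 + d ∧ w 3 = w 2 + f 2 ∧ w 4 = w 3 + f 3 ∧ w 4 = w 2 + f 4 ∧
      w 6 = w 5 + f 5 ∧ w 7 = w 6 + f 6 ∧ w 8 = w 7 + f 7 ∧ w 8 = w 9 + f 8 ∧
      w 9 = w 5 + f 9 := by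
  have nz : ∀ m : ℕ, 0 < m → m < n → (m : ZMod n) ≠ 0 := by
    intro m h0 h1 h
    rw [ZMod.natCast_eq_zero_iff] at h
    exact absurd (Nat.le_of_dvd h0 h) (by omega)
  have n1 : ∀ c, (f c : ZMod n) ≠ 0 := fun c => nz _ (hf c).1 (by have := hf c; omega)
  have n2 : ∀ c c', (f c : ZMod n) + f c' ≠ 0 := fun c c' => by
    rw [← Nat.cast_add]
    exact nz _ (by have := hf c; omega) (by have := hf c; have := hf c'; omega)
  have n3 : ∀ c c', c ≠ c' → (f c : ZMod n) ≠ f c' := fun c c' hc h => by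
    rw [ZMod.natCast_eq_natCast_iff', Nat.mod_eq_of_lt (by have := hf c; omega),
      Nat.mod_eq_of_lt (by have := hf c'; omega)] at h
    exact hc (hi h)
  have nd : (d : ZMod n) ≠ 0 := nz _ hd.1 (by omega)
  have e3 : (f 2 : ZMod n) + f 3 = f 4 := by exact_mod_cast congrArg (Nat.cast : ℕ → ZMod n) h3
  have e5 : (f 5 : ZMod n) + f 6 + f 7 = f 8 + f 9 := by
    exact_mod_cast congrArg (Nat.cast : ℕ → ZMod n) h5
  -- the pentagon
  obtain ⟨P5, hP5⟩ : ∃ P : Fin 5 → ZMod n,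
    P = ![0, (f 5 : ZMod n), f 5 + f 6, f 5 + f 6 + f 7, f 9] := ⟨_, rfl⟩
  have hP5i : ∀ i j, i < j → P5 i ≠ P5 j := by
    have a1 := n1 5
    have a2 := n2 5 6
    have a3 := n2 8 9
    have a4 := n1 9
    have a5 := n1 6
    have a6 := n2 6 7
    have a7 := n3 5 9 (by decide)
    have a8 := n1 7
    have a9 := n3 7 8 (by decide)
    have a10 := n1 8
    intro i j hij h
    subst hP5
    fin_cases i <;> fin_cases j <;> first | (exact absurd hij (by decide)) | simp at h
    all_goals first
      | exact a1 h | exact a1 h.symm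
      | exact a2 (by linear_combination -h)
      | exact a3 (by linear_combination -h - e5)
      | exact a4 (by linear_combination -h)
      | exact a4 h
      | exact a5 (by linear_combination -h)
      | exact a5 h
      | exact a6 (by linear_combination -h)
      | exact a7 h
      | exact a8 (by linear_combination -h)
      | exact a8 h
      | exact a9 (by linear_combination e5 - h)
      | exact a10 (by linear_combination h - e5)
  obtain ⟨P3, hP3⟩ : ∃ P : Fin 3 → ZMod n, P = ![0, (f 2 : ZMod n), f 4] := ⟨_, rfl⟩
  have hP3i : ∀ i j, i < j → P3 i ≠ P3 j := by
    have a1 := n1 2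
    have a2 := n1 4
    have a3 := n3 2 4 (by decide)
    intro i j hij h
    subst hP3
    fin_cases i <;> fin_cases j <;> first | (exact absurd hij (by decide)) | simp at h
    all_goals first | exact a1 h.symm | exact a1 h | exact a2 h | exact a2 h.symm | exact a3 h
  obtain ⟨t, ht⟩ := exists_shift (n := n) (by omega) P5 P3
  obtain ⟨P8, hP8⟩ : ∃ P : Fin 8 → ZMod n,
    P = ![P3 0 + t, P3 1 + t, P3 2 + t, P5 0, P5 1, P5 2, P5 3, P5 4] := ⟨_, rfl⟩
  have hP8i : ∀ i j, i < j → P8 i ≠ P8 j := by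
    intro i j hij h
    subst hP8
    fin_cases i <;> fin_cases j <;> first
      | exact absurd hij (by decide)
      | exact ht _ _ h.symm
      | exact hP5i _ _ (by decide) h
      | exact hP3i _ _ (by decide) (add_right_cancel h)
  obtain ⟨P2, hP2⟩ : ∃ P : Fin 2 → ZMod n, P = ![0, (d : ZMod n)] := ⟨_, rfl⟩
  obtain ⟨r, hr⟩ := exists_shift (n := n) (by omega) P8 P2
  have hP2i : P2 0 + r ≠ P2 1 + r := by
    intro h
    subst hP2
    simp at h
    exact nd h
  refine ⟨![P2 0 + r, P2 1 + r, P8 0, P8 1, P8 2, P8 3, P8 4, P8 5, P8 6, P8 7], ?_, ?_⟩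
  · have : ∀ i j : Fin 10, i < j →
      (![P2 0 + r, P2 1 + r, P8 0, P8 1, P8 2, P8 3, P8 4, P8 5, P8 6, P8 7] : Fin 10 → ZMod n) i ≠
      (![P2 0 + r, P2 1 + r, P8 0, P8 1, P8 2, P8 3, P8 4, P8 5, P8 6, P8 7] : Fin 10 → ZMod n) j := by
      intro i j hij h
      fin_cases i <;> fin_cases j <;> first
        | exact absurd hij (by decide)
        | exact hP2i h
        | exact hr _ _ h.symm
        | exact hP8i _ _ (by decide) h
    intro i j h
    rcases lt_trichotomy i j with hij | hij | hij
    · exact absurd h (this i j hij)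
    · exact hij
    · exact absurd h.symm (this j i hij)
  · subst hP2 hP8 hP3 hP5
    simp
    refine ⟨by ring, by ring, by linear_combination -e3, by ring, by linear_combination e5⟩

/-! ### The short orbits (differences 1 and 2) -/

def shortV : Fin 4 → Fin 10 → ℕ :=
  ![![15, 13, 10, 11, 9, 5, 4, 6, 8, 7],
    ![8, 9, 10, 11, 12, 5, 4, 2, 1, 3],
    ![12, 14, 1, 2, 3, 5, 4, 6, 8, 7],
    ![8, 9, 10, 11, 12, 5, 6, 4, 2, 3]]

def shortB : Fin 4 → Fin 10 → Fin 2 :=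
  ![![0, 1, 1, 1, 0, 1, 0, 0, 1, 1],
    ![0, 1, 0, 0, 1, 0, 0, 0, 0, 0],
    ![0, 1, 0, 0, 1, 1, 1, 1, 1, 0],
    ![0, 0, 0, 1, 0, 1, 0, 1, 1, 1]]

lemma shortV_lt : ∀ m j, shortV m j < 25 := by decide

lemma shortV_inj : ∀ m j j', shortV m j = shortV m j' → j = j' := by decide

set_option maxRecDepth 100000 in
lemma short_cover : ∀ (D : Fin 2) (r : Fin 5) (p q : Fin 2), ∃ m j,
    (shortV m j % 5 = r.1 ∧ shortB m j + 1 = p ∧ shortV m (sig j) = shortV m j + (D.1 + 1) ∧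
      shortB m (sig j) = q) ∨
    (shortV m j = shortV m (sig j) + (D.1 + 1) ∧ shortB m j + 1 = q ∧
      shortV m (sig j) % 5 = r.1 ∧ shortB m (sig j) = p) := by decide

/-! ### The full orbits -/

def longB (τ : Fin 2 × Fin 2) : Fin 10 → Fin 2 :=
  ![0, τ.2, τ.1, τ.2, τ.1 + τ.2, τ.1, τ.2, τ.1, τ.2, τ.1 + τ.2]

lemma longB_cover : ∀ c : Fin 10, 2 ≤ c → ∀ p q : Fin 2,
    ∃ τ, longB τ c + 1 = p ∧ longB τ (sig c) = q := by decide

lemma longB_cover2 : ∀ α p q : Fin 2, ∃ β,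
    (longB (α, β) 0 + 1 = p ∧ longB (α, β) 1 = q) ∨
    (longB (α, β) 1 + 1 = q ∧ longB (α, β) 0 = p) := by decide

lemma long_cover {n : ℕ} (w : Fin 2 → Fin 10 → ZMod n) (f : Fin 10 → ℕ)
    (h0 : w 0 1 = w 0 0 + f 0) (h1 : w 1 1 = w 1 0 + f 1)
    (hw : ∀ α, w α 3 = w α 2 + f 2 ∧ w α 4 = w α 3 + f 3 ∧ w α 4 = w α 2 + f 4 ∧
      w α 6 = w α 5 + f 5 ∧ w α 7 = w α 6 + f 6 ∧ w α 8 = w α 7 + f 7 ∧ w α 8 = w α 9 + f 8 ∧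
      w α 9 = w α 5 + f 9) (c : Fin 10) (p q : Fin 2) :
    ∃ τ j,
      (longB τ j + 1 = p ∧ w τ.1 (sig j) = w τ.1 j + f c ∧ longB τ (sig j) = q) ∨
      (longB τ j + 1 = q ∧ w τ.1 j = w τ.1 (sig j) + f c ∧ longB τ (sig j) = p) := by
  by_cases hc : 2 ≤ c
  · obtain ⟨τ, t1, t2⟩ := longB_cover c hc p q
    obtain ⟨τ', t1', t2'⟩ := longB_cover c hc q p
    obtain ⟨a2, a3, a4, a5, a6, a7, a8, a9⟩ := hw τ.1
    obtain ⟨a2', a3', a4', a5', a6', a7', a8', a9'⟩ := hw τ'.1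
    fin_cases c
    · exact absurd hc (by decide)
    · exact absurd hc (by decide)
    · exact ⟨τ, 2, Or.inl ⟨t1, a2, t2⟩⟩
    · exact ⟨τ, 3, Or.inl ⟨t1, a3, t2⟩⟩
    · exact ⟨τ', 4, Or.inr ⟨t1', a4', t2'⟩⟩
    · exact ⟨τ, 5, Or.inl ⟨t1, a5, t2⟩⟩
    · exact ⟨τ, 6, Or.inl ⟨t1, a6, t2⟩⟩
    · exact ⟨τ, 7, Or.inl ⟨t1, a7, t2⟩⟩
    · exact ⟨τ', 8, Or.inr ⟨t1', a8', t2'⟩⟩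
    · exact ⟨τ', 9, Or.inr ⟨t1', a9', t2'⟩⟩
  · have : c = 0 ∨ c = 1 := by revert c; decide
    rcases this with rfl | rfl
    · obtain ⟨β, ⟨t1, t2⟩ | ⟨t1, t2⟩⟩ := longB_cover2 0 p q
      · exact ⟨(0, β), 0, Or.inl ⟨t1, h0, t2⟩⟩
      · exact ⟨(0, β), 1, Or.inr ⟨t1, h0, t2⟩⟩
    · obtain ⟨β, ⟨t1, t2⟩ | ⟨t1, t2⟩⟩ := longB_cover2 1 p q
      · exact ⟨(1, β), 0, Or.inl ⟨t1, h1, t2⟩⟩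
      · exact ⟨(1, β), 1, Or.inr ⟨t1, h1, t2⟩⟩

/-- A residue of the right class mod 5 is reached by a short translation. -/
lemma short_translate {k n : ℕ} [NeZero n] (hn : n = 20 * k + 5) (x : ZMod n) (u : ℕ)
    (hu : u < 25) (hk : 1 ≤ k) (h : u % 5 = x.val % 5) :
    ∃ y : Fin (4 * k + 1), (u : ZMod n) + 5 * ((y.1 : ℕ) : ZMod n) = x := by
  have hx := ZMod.val_lt x
  rcases Nat.lt_or_ge x.val u with hlt | hge
  · refine ⟨⟨(x.val + n - u) / 5, by omega⟩, ?_⟩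
    have : u + 5 * ((x.val + n - u) / 5) = x.val + n := by omega
    have h2 := congrArg (Nat.cast : ℕ → ZMod n) this
    push_cast at h2
    simpa using h2
  · refine ⟨⟨(x.val - u) / 5, by omega⟩, ?_⟩
    have : u + 5 * ((x.val - u) / 5) = x.val := by omega
    have h2 := congrArg (Nat.cast : ℕ → ZMod n) this
    push_cast at h2
    simpa using h2

theorem main (k n s : ℕ) (hk : 1 ≤ k) (hn : n = 20 * k + 5) (hs : s = n - 10) :
    HOPSolution n s 3 ![2, 3, 5] := by
  haveI : NeZero n := ⟨by omega⟩
  obtain ⟨f, hf1, hf2, hf3, hf4, hf5⟩ := exists_diffs_surj k hk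
  have hbase : ∀ (i : Fin k) (α : Fin 2), _ := fun i α =>
    exists_base (n := n) (by omega) (f i (if α = 0 then 0 else 1)) (f i)
      (by have := hf1 i (if α = 0 then 0 else 1); omega)
      (fun c => by have := hf1 i c; omega) (hf2 i) (hf4 i) (hf5 i)
  choose w hwi hw01 hw using hbase
  let φ : ZMod n ≃ Fin n := (ZMod.finEquiv n).symm.toEquiv
  let V : (Fin k × ZMod n × (Fin 2 × Fin 2)) ⊕ (Fin 4 × Fin (4 * k + 1)) → Fin 10 → ZMod n :=
    Sum.elim (fun z j => w z.1 z.2.2.1 j + z.2.1)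
      (fun z j => (shortV z.1 j : ZMod n) + 5 * ((z.2.1 : ℕ) : ZMod n))
  let B : (Fin k × ZMod n × (Fin 2 × Fin 2)) ⊕ (Fin 4 × Fin (4 * k + 1)) → Fin 10 → Fin 2 :=
    Sum.elim (fun z => longB z.2.2) (fun z => shortB z.1)
  have hV : ∀ t, Function.Injective (V t) := by
    rintro (⟨i, x, τ⟩ | ⟨m, y⟩) j j' h
    · exact hwi i τ.1 (add_right_cancel h)
    · have h2 := add_right_cancel h
      have l1 := shortV_lt m j
      have l2 := shortV_lt m j'
      simp only at h2
      rw [ZMod.natCast_eq_natCast_iff', Nat.mod_eq_of_lt (by omega),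
        Nat.mod_eq_of_lt (by omega)] at h2
      exact shortV_inj m j j' h2
  have cover : ∀ (x : ZMod n) (D : ℕ), 1 ≤ D → D ≤ 10 * k + 2 → ∀ p q : Fin 2, ∃ t j,
      (V t j = x ∧ B t j + 1 = p ∧ V t (sig j) = x + D ∧ B t (sig j) = q) ∨
      (V t j = x + D ∧ B t j + 1 = q ∧ V t (sig j) = x ∧ B t (sig j) = p) := by
    intro x D hD1 hD2 p q
    rcases Nat.lt_or_ge D 3 with hD | hD
    · obtain ⟨m, j, ⟨h1, h2, h3, h4⟩ | ⟨h1, h2, h3, h4⟩⟩ :=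
        short_cover ⟨D - 1, by omega⟩ ⟨x.val % 5, by omega⟩ p q
      · obtain ⟨y, hy⟩ := short_translate hn x _ (shortV_lt m j) hk h1
        refine ⟨Sum.inr (m, y), j, Or.inl ⟨hy, h2, ?_, h4⟩⟩
        have h5 : shortV m (sig j) = shortV m j + D := by rw [h3]; simp only; omega
        change (shortV m (sig j) : ZMod n) + 5 * ((y.1 : ℕ) : ZMod n) = x + D
        rw [h5, ← hy]; push_cast; ring
      · obtain ⟨y, hy⟩ := short_translate hn x _ (shortV_lt m (sig j)) hk h3
        refine ⟨Sum.inr (m, y), j, Or.inr ⟨?_, h2, hy, h4⟩⟩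
        have h5 : shortV m j = shortV m (sig j) + D := by rw [h1]; simp only; omega
        change (shortV m j : ZMod n) + 5 * ((y.1 : ℕ) : ZMod n) = x + D
        rw [h5, ← hy]; push_cast; ring
    · obtain ⟨i, c, rfl⟩ := hf3 D hD hD2
      obtain ⟨τ, j, ⟨h1, h2, h3⟩ | ⟨h1, h2, h3⟩⟩ :=
        long_cover (w i) (f i) (hw01 i 0) (hw01 i 1) (hw i) c p q
      · refine ⟨Sum.inl (i, x - w i τ.1 j, τ), j, Or.inl ⟨?_, h1, ?_, h3⟩⟩
        · change w i τ.1 j + (x - w i τ.1 j) = x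
          ring
        · change w i τ.1 (sig j) + (x - w i τ.1 j) = x + f i c
          rw [h2]; ring
      · refine ⟨Sum.inl (i, x - w i τ.1 (sig j), τ), j, Or.inr ⟨?_, h1, ?_, h3⟩⟩
        · change w i τ.1 j + (x - w i τ.1 (sig j)) = x + f i c
          rw [h2]; ring
        · change w i τ.1 (sig j) + (x - w i τ.1 (sig j)) = x
          ring
  refine solution_of_cover (by omega) ?_ (fun t j => φ (V t j))
    (fun t => φ.injective.comp (hV t)) B ?_
  · simp only [Fintype.card_sum, Fintype.card_prod, Fintype.card_fin, ZMod.card]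
    subst hn
    simp only [Nat.add_sub_cancel, show 20 * k + 5 - 1 = 20 * k + 4 by omega]
    ring
  · intro x y hxy p q
    obtain ⟨x, rfl⟩ := φ.surjective x
    obtain ⟨y, rfl⟩ := φ.surjective y
    simp only [φ.injective.eq_iff]
    have hne : x ≠ y := fun h => hxy (h ▸ rfl)
    have hd : (y - x).val ≠ 0 := by
      rw [Ne, ZMod.val_eq_zero, sub_eq_zero]; exact hne.symm
    have hlt := ZMod.val_lt (y - x)
    rcases Nat.lt_or_ge (10 * k + 2) (y - x).val with hbig | hsmall
    · obtain ⟨t, j, h⟩ := cover y (n - (y - x).val) (by omega) (by omega) q p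
      have hx : y + ((n - (y - x).val : ℕ) : ZMod n) = x := by
        rw [Nat.cast_sub hlt.le]; simp
      rw [hx] at h
      exact ⟨t, j, h.symm⟩
    · obtain ⟨t, j, h⟩ := cover x (y - x).val (by omega) hsmall p q
      have hx : x + (((y - x).val : ℕ) : ZMod n) = y := by simp
      rw [hx] at h
      exact ⟨t, j, h⟩

end HOPaux

/-- Lemma 6.13: for `k ≥ 1`, `n = 20k + 5` and `s = n - 10`,
`HOP(2^⟨s⟩, 4, 6, 10)` has a solution. -/
theorem hop_C2_C3_C5_mod_five (k n s : ℕ) (hk : 1 ≤ k) (hn : n = 20 * k + 5)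
    (hs : s = n - 10) :
    HOPSolution n s 3 ![2, 3, 5] := by
  exact HOPaux.main k n s hk hn hs
end
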